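/- Let Δ ⊂ ℝ^d be a lattice simplex of dimension d with normalized volume Vol(Δ) = 4 which is not a lattice pyramid, and write its δ-polynomial as 1 + t^{i_1} + t^{i_2} + t^{i_3} with 1 ≤ i_1 ≤ i_2 ≤ i_3. Then Δ is unimodularly equivalent to exactly one of the following three simplices: (1) Δ^(4)_1 = conv{0, e_1, …, e_{d−1}, 2·Σ_{i=1}^{i_1−2i_2+i_3} e_i + Σ_{i=i_1−2i_2+i_3+1, i≠d}^{2i_1−i_2} e_i + 3·Σ_{i=2i_1−i_2+1}^{d−1} e_i + 4e_d}, which occurs only when i_1 < i_2 < i_3, 2i_2 ≤ i_1 + i_3 and d = i_1 + i_3 − 1; (2) Δ^(4)_2 = conv{0, e_1, …, e_{d−1}, 2·Σ_{i=1}^{−2i_1+i_2+i_3} e_i + Σ_{i=−2i_1+i_2+i_3+1, i≠d}^{−i_1+2i_2} e_i + 3·Σ_{i=−i_1+2i_2+1}^{d−1} e_i + 4e_d}, which occurs only when d = i_2 + i_3 − 1; (3) Δ^(4)_3 = conv{0, e_1, …, e_{d−2}, Σ_{i=−i_1+i_2+i_3}^{d−2} e_i + 2e_{d−1}, Σ_{i=1}^{−i_1+i_2+i_3−1}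 e_i + Σ_{i=2i_3−1}^{d−2} e_i + 2e_d}, which occurs only when d = i_1 + i_2 + i_3 − 1. -/

import Mathlib

open Pointwise Polynomial

noncomputable section

/-- The set of lattice points of `ℝ^d` (points with integer coordinates). -/
def latticePts (d : ℕ) : Set (Fin d → ℝ) := {x | ∀ i, ∃ z : ℤ, x i = (z : ℝ)}

/-- A lattice polytope: the convex hull of finitely many lattice points. -/
def IsLatticePolytope {d : ℕ} (P : Set (Fin d → ℝ)) : Prop :=
  ∃ V : Finset (Fin d → ℝ), (V : Set (Fin d → ℝ)) ⊆ latticePts d ∧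
    P = convexHull ℝ (V : Set (Fin d → ℝ))

/-- `|nP ∩ ℤ^d|`. -/
def ehrhartCount {d : ℕ} (P : Set (Fin d → ℝ)) (n : ℕ) : ℕ :=
  (latticePts d ∩ (n : ℝ) • P).ncard

/-- The Ehrhart series `1 + Σ_{n ≥ 1} |nP ∩ ℤ^d| tⁿ`. -/
def ehrhartSeries {d : ℕ} (P : Set (Fin d → ℝ)) : PowerSeries ℤ :=
  PowerSeries.mk fun n => if n = 0 then 1 else (ehrhartCount P n : ℤ)

/-- `p` is the δ-polynomial of the lattice polytope `P ⊆ ℝ^d` of dimension `d`,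
i.e. `(1 - t)^(d+1) (1 + Σ_{n ≥ 1} |nP ∩ ℤ^d| tⁿ) = p`. -/
def HasDeltaPoly {d : ℕ} (P : Set (Fin d → ℝ)) (p : Polynomial ℤ) : Prop :=
  (1 - PowerSeries.X) ^ (d + 1) * ehrhartSeries P = (p : PowerSeries ℤ)

/-- Unimodular equivalence: an affine map carrying `ℤ^d ∩ aff P` bijectively onto
`ℤ^e ∩ aff Q` and mapping `P` onto `Q`. -/
def UnimodEquiv {d e : ℕ} (P : Set (Fin d → ℝ)) (Q : Set (Fin e → ℝ)) : Prop :=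
  ∃ f : (Fin d → ℝ) →ᵃ[ℝ] (Fin e → ℝ),
    Set.BijOn f (latticePts d ∩ (affineSpan ℝ P : Set (Fin d → ℝ)))
      (latticePts e ∩ (affineSpan ℝ Q : Set (Fin e → ℝ))) ∧ f '' P = Q

/-- The lattice pyramid `Pyr(Q) = conv(Q × {0}, (0,…,0,1)) ⊆ ℝ^{e+1}`. -/
def pyramidOver {e : ℕ} (Q : Set (Fin e → ℝ)) : Set (Fin (e + 1) → ℝ) :=
  convexHull ℝ
    ((fun x : Fin e → ℝ => Fin.snoc x (0 : ℝ)) '' Q ∪ {Fin.snoc (0 : Fin e → ℝ) (1 : ℝ)})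

/-- `P` is a lattice pyramid over some (full-dimensional) lattice polytope. -/
def IsLatticePyramid {d : ℕ} (P : Set (Fin d → ℝ)) : Prop :=
  ∃ (e : ℕ) (Q : Set (Fin e → ℝ)), IsLatticePolytope Q ∧ affineSpan ℝ Q = ⊤ ∧
    UnimodEquiv P (pyramidOver Q)

/-- `P ⊆ ℝ^d` is a simplex (of some dimension). -/
def IsSimplex {d : ℕ} (P : Set (Fin d → ℝ)) : Prop :=
  ∃ (n : ℕ) (v : Fin (n + 1) → Fin d → ℝ), AffineIndependent ℝ v ∧
    P = convexHull ℝ (Set.range v)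

/-- A full-dimensional lattice simplex of dimension `d` in `ℝ^d`. -/
def IsLatticeSimplexFD {d : ℕ} (Δ : Set (Fin d → ℝ)) : Prop :=
  ∃ v : Fin (d + 1) → Fin d → ℝ, AffineIndependent ℝ v ∧
    (∀ i, v i ∈ latticePts d) ∧ Δ = convexHull ℝ (Set.range v)

/-- `ℤ((P,1) ∩ ℤ^{d+1}) = ℤ^{d+1}`: the lattice points of `P`, with last coordinate `1`
appended, generate all of `ℤ^{d+1}` as a group. -/
def SpansLattice {d : ℕ} (P : Set (Fin d → ℝ)) : Prop :=
  AddSubgroup.closure {y : Fin (d + 1) → ℤ |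
    y (Fin.last d) = 1 ∧ (fun i : Fin d => (y i.castSucc : ℝ)) ∈ P} = ⊤

/-- The finite abelian group `Λ_Δ ⊆ (ℝ/ℤ)^{d+1}` attached to a lattice simplex with
ordered vertices `v 0, …, v d`, encoded by its canonical representatives in `[0,1)`. -/
def simplexLambda {d : ℕ} (v : Fin (d + 1) → Fin d → ℝ) : Set (Fin (d + 1) → ℝ) :=
  {c | (∀ i, 0 ≤ c i ∧ c i < 1) ∧
    (∀ j : Fin d, ∃ z : ℤ, (∑ i, c i * v i j) = (z : ℝ)) ∧
    (∃ z : ℤ, (∑ i, c i) = (z : ℝ))}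

/-- The standard basis vector `e_j` of `ℝ^d` (0-indexed). -/
def stdE (d : ℕ) (j : Fin d) : Fin d → ℝ := fun i => if i = j then 1 else 0

/-- `Δ⁽⁴⁾₁ = conv{0, e₁, …, e_{d−1}, w}` with
`w = 2·Σ_{i=1}^{i₁−2i₂+i₃} eᵢ + Σ_{i=i₁−2i₂+i₃+1, i≠d}^{2i₁−i₂} eᵢ + 3·Σ_{i=2i₁−i₂+1}^{d−1} eᵢ + 4e_d`. -/
def delta4Simplex1 (d i1 i2 i3 : ℕ) : Set (Fin d → ℝ) :=
  convexHull ℝ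
    ({0, fun j : Fin d =>
        if (j : ℕ) = d - 1 then (4 : ℝ)
        else if ((j : ℕ) : ℤ) + 1 ≤ (i1 : ℤ) - 2 * (i2 : ℤ) + (i3 : ℤ) then 2
        else if ((j : ℕ) : ℤ) + 1 ≤ 2 * (i1 : ℤ) - (i2 : ℤ) then 1 else 3} ∪
      {x | ∃ j : Fin d, (j : ℕ) < d - 1 ∧ x = stdE d j})

/-- `Δ⁽⁴⁾₂ = conv{0, e₁, …, e_{d−1}, w}` with
`w = 2·Σ_{i=1}^{−2i₁+i₂+i₃} eᵢ + Σ_{i=−2i₁+i₂+i₃+1, i≠d}^{−i₁+2i₂} eᵢ + 3·Σ_{i=−i₁+2i₂+1}^{d−1} eᵢ + 4e_d`. -/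
def delta4Simplex2 (d i1 i2 i3 : ℕ) : Set (Fin d → ℝ) :=
  convexHull ℝ
    ({0, fun j : Fin d =>
        if (j : ℕ) = d - 1 then (4 : ℝ)
        else if ((j : ℕ) : ℤ) + 1 ≤ -2 * (i1 : ℤ) + (i2 : ℤ) + (i3 : ℤ) then 2
        else if ((j : ℕ) : ℤ) + 1 ≤ -(i1 : ℤ) + 2 * (i2 : ℤ) then 1 else 3} ∪
      {x | ∃ j : Fin d, (j : ℕ) < d - 1 ∧ x = stdE d j})

/-- `Δ⁽⁴⁾₃ = conv{0, e₁, …, e_{d−2}, u, v}` with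
`u = Σ_{i=−i₁+i₂+i₃}^{d−2} eᵢ + 2e_{d−1}` and
`v = Σ_{i=1}^{−i₁+i₂+i₃−1} eᵢ + Σ_{i=2i₃−1}^{d−2} eᵢ + 2e_d`. -/
def delta4Simplex3 (d i1 i2 i3 : ℕ) : Set (Fin d → ℝ) :=
  convexHull ℝ
    ({0,
      fun j : Fin d =>
        if (j : ℕ) = d - 2 then (2 : ℝ)
        else if (-(i1 : ℤ) + (i2 : ℤ) + (i3 : ℤ) ≤ ((j : ℕ) : ℤ) + 1 ∧
            ((j : ℕ) : ℤ) + 1 ≤ (d : ℤ) - 2) then 1 else 0,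
      fun j : Fin d =>
        if (j : ℕ) = d - 1 then (2 : ℝ)
        else if (((j : ℕ) : ℤ) + 1 ≤ -(i1 : ℤ) + (i2 : ℤ) + (i3 : ℤ) - 1 ∨
            (2 * (i3 : ℤ) - 1 ≤ ((j : ℕ) : ℤ) + 1 ∧ ((j : ℕ) : ℤ) + 1 ≤ (d : ℤ) - 2))
          then 1 else 0} ∪
      {x | ∃ j : Fin d, (j : ℕ) < d - 2 ∧ x = stdE d j})

/-- The real numbers that are integers. -/
abbrev intReals : Subring ℝ := (Int.castRingHom ℝ).range

lemma mem_intReals {x : ℝ} : x ∈ intReals ↔ ∃ z : ℤ, x = z := by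
  simp [intReals, RingHom.mem_range, eq_comm]

lemma intCast_mem_intReals (z : ℤ) : (z : ℝ) ∈ intReals := mem_intReals.2 ⟨z, rfl⟩

lemma natCast_mem_intReals (n : ℕ) : (n : ℝ) ∈ intReals := mem_intReals.2 ⟨n, by simp⟩

lemma fract_sub_mem_intReals (x : ℝ) : Int.fract x - x ∈ intReals :=
  mem_intReals.2 ⟨-⌊x⌋, by rw [← Int.self_sub_floor]; push_cast; ring⟩

lemma eq_of_sub_mem_intReals {x y : ℝ} (hx : 0 ≤ x ∧ x < 1) (hy : 0 ≤ y ∧ y < 1)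
    (h : x - y ∈ intReals) : x = y := by
  obtain ⟨z, hz⟩ := mem_intReals.1 h
  have h1 : (-1 : ℝ) < z := by linarith
  have h2 : (z : ℝ) < 1 := by linarith
  have h3 : -1 < z := by exact_mod_cast h1
  have h4 : z < 1 := by exact_mod_cast h2
  have : z = 0 := by omega
  subst this
  simp at hz
  linarith

/-- The coefficient vectors `c` for which `∑ c i • (v i, 1)` is a lattice point. -/
def coeffLattice {d : ℕ} (v : Fin (d + 1) → Fin d → ℝ) : AddSubgroup (Fin (d + 1) → ℝ) where
  carrier := {c | (∀ j, ∑ i, c i * v i j ∈ intReals) ∧ ∑ i, c i ∈ intReals}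
  zero_mem' := by simp
  add_mem' := by
    rintro a b ⟨ha, ha'⟩ ⟨hb, hb'⟩
    refine ⟨fun j => ?_, ?_⟩
    · simpa [add_mul, Finset.sum_add_distrib] using add_mem (ha j) (hb j)
    · simpa [Finset.sum_add_distrib] using add_mem ha' hb'
  neg_mem' := by
    rintro a ⟨ha, ha'⟩
    refine ⟨fun j => ?_, ?_⟩
    · simpa using neg_mem (ha j)
    · simpa using neg_mem ha'

lemma mem_coeffLattice {d : ℕ} {v : Fin (d + 1) → Fin d → ℝ} {c : Fin (d + 1) → ℝ} :
    c ∈ coeffLattice v ↔ (∀ j, ∑ i, c i * v i j ∈ intReals) ∧ ∑ i, c i ∈ intReals := Iff.rfl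

lemma mem_latticePts {d : ℕ} {x : Fin d → ℝ} : x ∈ latticePts d ↔ ∀ j, x j ∈ intReals := by
  simp only [latticePts, mem_intReals, Set.mem_ofPred_eq]

lemma mem_simplexLambda {d : ℕ} {v : Fin (d + 1) → Fin d → ℝ} {c : Fin (d + 1) → ℝ} :
    c ∈ simplexLambda v ↔ c ∈ coeffLattice v ∧ ∀ i, 0 ≤ c i ∧ c i < 1 := by
  simp only [simplexLambda, Set.mem_ofPred_eq, mem_coeffLattice, mem_intReals]
  tauto

lemma mem_coeffLattice_of_int {d : ℕ} {v : Fin (d + 1) → Fin d → ℝ}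
    (hv : ∀ i, v i ∈ latticePts d) {c : Fin (d + 1) → ℝ} (hc : ∀ i, c i ∈ intReals) :
    c ∈ coeffLattice v :=
  ⟨fun j => sum_mem fun i _ => mul_mem (hc i) (mem_latticePts.1 (hv i) j),
    sum_mem fun i _ => hc i⟩

lemma mem_coeffLattice_iff_of_sub {d : ℕ} {v : Fin (d + 1) → Fin d → ℝ}
    (hv : ∀ i, v i ∈ latticePts d) {b c : Fin (d + 1) → ℝ} (h : ∀ i, b i - c i ∈ intReals) :
    b ∈ coeffLattice v ↔ c ∈ coeffLattice v := by
  have h' : b - c ∈ coeffLattice v := mem_coeffLattice_of_int hv h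
  constructor <;> intro hb
  · simpa using sub_mem hb h'
  · simpa using add_mem h' hb

lemma fract_mem_simplexLambda {d : ℕ} {v : Fin (d + 1) → Fin d → ℝ}
    (hv : ∀ i, v i ∈ latticePts d) {c : Fin (d + 1) → ℝ} (hc : c ∈ coeffLattice v) :
    (fun i => Int.fract (c i)) ∈ simplexLambda v :=
  mem_simplexLambda.2 ⟨(mem_coeffLattice_iff_of_sub hv fun i => fract_sub_mem_intReals (c i)).2 hc,
    fun _ => ⟨Int.fract_nonneg _, Int.fract_lt_one _⟩⟩

lemma eq_of_affineIndependent {d : ℕ} {v : Fin (d + 1) → Fin d → ℝ} (hv : AffineIndependent ℝ v)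
    {b c : Fin (d + 1) → ℝ} (h : ∑ i, b i = ∑ i, c i)
    (h' : ∀ j, ∑ i, b i * v i j = ∑ i, c i * v i j) : b = c := by
  funext i
  refine hv.eq_of_sum_eq_sum (s := Finset.univ) h ?_ i (Finset.mem_univ i)
  funext j
  simpa using h' j

lemma affineIndependent_of_forall {d : ℕ} {v : Fin (d + 1) → Fin d → ℝ}
    (h : ∀ c : Fin (d + 1) → ℝ, ∑ i, c i = 0 → (∀ j, ∑ i, c i * v i j = 0) → ∀ i, c i = 0) :
    AffineIndependent ℝ v := by
  rw [affineIndependent_iff_of_fintype]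
  intro w hw hw'
  refine h w hw fun j => ?_
  rw [Finset.univ.weightedVSub_eq_linear_combination hw] at hw'
  simpa using congrFun hw' j

lemma mem_convexHull_range_iff {ι E : Type*} [Fintype ι] [AddCommGroup E] [Module ℝ E]
    {v : ι → E} {x : E} : x ∈ convexHull ℝ (Set.range v) ↔
      ∃ c : ι → ℝ, (∀ i, 0 ≤ c i) ∧ ∑ i, c i = 1 ∧ ∑ i, c i • v i = x := by
  classical
  rw [show Set.range v = (fun c : ι → ℝ => ∑ i, c i • v i) '' Set.range
    (fun i j => if i = j then (1 : ℝ) else 0) by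
      ext; simp [Set.mem_range, ite_smul]]
  have : (fun c : ι → ℝ => ∑ i, c i • v i) = Fintype.linearCombination ℝ v := by
    ext; simp [Fintype.linearCombination_apply]
  rw [this, ← LinearMap.image_convexHull, convexHull_basis_eq_stdSimplex]
  simp only [Set.mem_image, stdSimplex, Set.mem_ofPred_eq, and_assoc,
    Fintype.linearCombination_apply]

lemma finite_simplexLambda {d : ℕ} {v : Fin (d + 1) → Fin d → ℝ} (hv : AffineIndependent ℝ v) :
    (simplexLambda v).Finite := by
  have hfin : ((Set.univ.pi fun j : Fin d => ((↑) : ℤ → ℝ) ''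
      Set.Icc (-⌈∑ i, |v i j|⌉) ⌈∑ i, |v i j|⌉) ×ˢ
      (((↑) : ℤ → ℝ) '' Set.Icc (0 : ℤ) (d + 1))).Finite :=
    (Set.Finite.pi fun j => (Set.finite_Icc _ _).image _).prod ((Set.finite_Icc _ _).image _)
  refine Set.Finite.of_injOn (f := fun c => (fun j => ∑ i, c i * v i j, ∑ i, c i)) ?_ ?_ hfin
  · intro c hc
    obtain ⟨⟨h1, h2⟩, h3⟩ := mem_simplexLambda.1 hc
    refine ⟨fun j _ => ?_, ?_⟩
    · obtain ⟨z, hz⟩ := mem_intReals.1 (h1 j)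
      refine ⟨z, ?_, hz.symm⟩
      have h4 : |∑ i, c i * v i j| ≤ ∑ i, |v i j| := by
        refine (Finset.abs_sum_le_sum_abs _ _).trans (Finset.sum_le_sum fun i _ => ?_)
        rw [abs_mul, abs_of_nonneg (h3 i).1]
        exact mul_le_of_le_one_left (abs_nonneg _) (h3 i).2.le
      rw [hz] at h4
      have h5 := (abs_le.1 (h4.trans (Int.le_ceil _)))
      exact ⟨by exact_mod_cast h5.1, by exact_mod_cast h5.2⟩
    · obtain ⟨z, hz⟩ := mem_intReals.1 h2
      refine ⟨z, ?_, hz.symm⟩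
      have h4 : 0 ≤ ∑ i, c i := Finset.sum_nonneg fun i _ => (h3 i).1
      have h5 : ∑ i, c i ≤ ∑ _i : Fin (d + 1), (1 : ℝ) := Finset.sum_le_sum fun i _ => (h3 i).2.le
      rw [hz] at h4 h5
      simp at h5
      exact ⟨by exact_mod_cast h4, by exact_mod_cast h5⟩
  · intro b _ c _ h
    simp only [Prod.mk.injEq] at h
    exact eq_of_affineIndependent hv h.2 (congrFun h.1)

/-- The height of a coefficient vector, i.e. the sum of its coordinates. -/
def height {n : ℕ} (c : Fin n → ℝ) : ℕ := ⌊∑ i, c i⌋₊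

lemma height_eq {d : ℕ} {v : Fin (d + 1) → Fin d → ℝ} {c : Fin (d + 1) → ℝ}
    (hc : c ∈ simplexLambda v) : (height c : ℝ) = ∑ i, c i := by
  obtain ⟨⟨-, h2⟩, h3⟩ := mem_simplexLambda.1 hc
  have h4 : 0 ≤ ∑ i, c i := Finset.sum_nonneg fun i _ => (h3 i).1
  obtain ⟨z, hz⟩ := mem_intReals.1 h2
  rw [height, hz]
  rw [hz] at h4
  lift z to ℕ using by exact_mod_cast h4
  simp

/-- Barycentric coordinates (scaled by `n`) of the lattice points of the `n`-th dilate. -/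
lemma latticePts_inter_smul_convexHull {d : ℕ} (v : Fin (d + 1) → Fin d → ℝ) (n : ℕ) :
    latticePts d ∩ (n : ℝ) • convexHull ℝ (Set.range v) =
      (fun c : Fin (d + 1) → ℝ => ∑ i, c i • v i) ''
        {c | c ∈ coeffLattice v ∧ (∀ i, 0 ≤ c i) ∧ ∑ i, c i = n} := by
  ext x
  simp only [Set.mem_inter_iff, Set.mem_smul_set, mem_convexHull_range_iff, Set.mem_image,
    Set.mem_ofPred_eq, mem_latticePts, mem_coeffLattice]
  constructor
  · rintro ⟨hx, y, ⟨c, hc, hc1, rfl⟩, rfl⟩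
    refine ⟨fun i => n * c i, ⟨⟨fun j => ?_, ?_⟩, fun i => mul_nonneg (Nat.cast_nonneg n) (hc i),
      ?_⟩, ?_⟩
    · simpa [Finset.mul_sum, mul_assoc] using hx j
    · simp [← Finset.mul_sum, hc1]
    · simp [← Finset.mul_sum, hc1]
    · simp [Finset.smul_sum, mul_smul]
  · rintro ⟨c, ⟨⟨h1, h2⟩, h3, h4⟩, rfl⟩
    refine ⟨fun j => by simpa using h1 j, ?_⟩
    rcases Nat.eq_zero_or_pos n with rfl | hn
    · have h5 : ∀ i, c i = 0 := fun i =>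
        (Finset.sum_eq_zero_iff_of_nonneg fun i _ => h3 i).1 (by simpa using h4) i
          (Finset.mem_univ i)
      exact ⟨v 0, ⟨Pi.single 0 1, fun i => by by_cases h : i = 0 <;> simp [h],
        by simp, by simp [Pi.single_apply]⟩, by simp [h5]⟩
    · have hn' : (n : ℝ) ≠ 0 := by positivity
      refine ⟨∑ i, (c i / n) • v i, ⟨fun i => c i / n, fun i => div_nonneg (h3 i) (by positivity),
        by rw [← Finset.sum_div, h4, div_self hn'], rfl⟩, ?_⟩
      rw [Finset.smul_sum]
      refine Finset.sum_congr rfl fun i _ => ?_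
      rw [smul_smul, mul_div_cancel₀ _ hn']

lemma ncard_coeffLattice_eq {d : ℕ} {v : Fin (d + 1) → Fin d → ℝ}
    (hv : AffineIndependent ℝ v) (hvl : ∀ i, v i ∈ latticePts d) (n : ℕ) :
    {c | c ∈ coeffLattice v ∧ (∀ i, 0 ≤ c i) ∧ ∑ i, c i = n}.ncard =
      ∑ c ∈ (finite_simplexLambda hv).toFinset,
        if height c ≤ n then (d + (n - height c)).choose d else 0 := by
  classical
  set F : (Σ _ : Fin (d + 1) → ℝ, Fin (d + 1) →₀ ℕ) → Fin (d + 1) → ℝ :=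
    fun p i => p.1 i + p.2 i with hF
  set S := (finite_simplexLambda hv).toFinset.sigma fun c =>
    if height c ≤ n then Finset.finsuppAntidiag (Finset.univ : Finset (Fin (d + 1))) (n - height c)
      else ∅ with hS
  have hcard : S.card = ∑ c ∈ (finite_simplexLambda hv).toFinset,
        if height c ≤ n then (d + (n - height c)).choose d else 0 := by
    rw [hS, Finset.card_sigma]
    refine Finset.sum_congr rfl fun c _ => ?_
    split_ifs
    · rw [Finset.card_finsuppAntidiag_nat_eq_choose, Finset.card_univ, Fintype.card_fin,
        show d + 1 + (n - height c) - 1 = d + (n - height c) by omega,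
        Nat.choose_symm_add]
    · simp
  have hmem : ∀ p, p ∈ S ↔ p.1 ∈ simplexLambda v ∧ height p.1 + ∑ i, p.2 i = n := by
    rintro ⟨c, m⟩
    simp only [hS, Finset.mem_sigma, Set.Finite.mem_toFinset]
    split_ifs with h
    · simp only [Finset.mem_finsuppAntidiag, Finset.subset_univ, and_true]
      refine and_congr_right fun _ => ?_
      change ∑ i, m i = n - height c ↔ _
      omega
    · simp only [Finset.notMem_empty, and_false, false_iff, not_and]
      omega
  have himg : {c | c ∈ coeffLattice v ∧ (∀ i, 0 ≤ c i) ∧ ∑ i, c i = n} = F '' (S : Set _) := by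
    ext c
    simp only [Set.mem_ofPred_eq, Set.mem_image, Finset.mem_coe, hmem]
    constructor
    · rintro ⟨h1, h2, h3⟩
      have h4 := fract_mem_simplexLambda hvl h1
      have h5 : ∀ i, Int.fract (c i) + (⌊c i⌋₊ : ℝ) = c i := fun i => by
        rw [natCast_floor_eq_intCast_floor (h2 i)]
        exact Int.fract_add_floor _
      refine ⟨⟨fun i => Int.fract (c i), Finsupp.equivFunOnFinite.symm fun i => ⌊c i⌋₊⟩,
        ⟨h4, ?_⟩, ?_⟩
      · have : ((height (fun i => Int.fract (c i)) + ∑ i, ⌊c i⌋₊ : ℕ) : ℝ) = n := by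
          push_cast
          rw [height_eq h4, ← Finset.sum_add_distrib, ← h3]
          exact Finset.sum_congr rfl fun i _ => h5 i
        exact_mod_cast this
      · funext i
        exact h5 i
    · rintro ⟨⟨b, m⟩, ⟨h1, h2⟩, rfl⟩
      have h3 := mem_simplexLambda.1 h1
      refine ⟨(mem_coeffLattice_iff_of_sub hvl fun i => ?_).2 h3.1, fun i => ?_, ?_⟩
      · simp [hF]
      · exact add_nonneg (h3.2 i).1 (Nat.cast_nonneg _)
      · simp only [hF, Finset.sum_add_distrib, ← height_eq h1]
        exact_mod_cast h2
  rw [himg, Set.InjOn.ncard_image, Set.ncard_coe_finset, hcard]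
  rintro ⟨b, m⟩ hb ⟨c, l⟩ hc h
  have hb' := (mem_simplexLambda.1 ((hmem _).1 hb).1).2
  have hc' := (mem_simplexLambda.1 ((hmem _).1 hc).1).2
  have h1 : b = c := funext fun i => by
    refine eq_of_sub_mem_intReals (hb' i) (hc' i) ?_
    have h2 : b i - c i = (l i : ℝ) - m i := by
      have := congrFun h i
      simp only [hF] at this
      linarith
    rw [h2]
    exact sub_mem (natCast_mem_intReals _) (natCast_mem_intReals _)
  subst h1
  have h2 : m = l := Finsupp.ext fun i => by
    have := congrFun h i
    simpa [hF] using this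
  rw [h2]

lemma one_sub_X_pow_mul_ehrhartSeries {d : ℕ} {v : Fin (d + 1) → Fin d → ℝ}
    (hv : AffineIndependent ℝ v) (hvl : ∀ i, v i ∈ latticePts d) :
    (1 - PowerSeries.X) ^ (d + 1) * ehrhartSeries (convexHull ℝ (Set.range v)) =
      ∑ c ∈ (finite_simplexLambda hv).toFinset, (PowerSeries.X : PowerSeries ℤ) ^ height c := by
  have key : ehrhartSeries (convexHull ℝ (Set.range v)) =
      (∑ c ∈ (finite_simplexLambda hv).toFinset, (PowerSeries.X : PowerSeries ℤ) ^ height c) *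
        PowerSeries.mk fun n => ((d + n).choose d : ℤ) := by
    ext n
    have h1 : (if n = 0 then 1 else (ehrhartCount (convexHull ℝ (Set.range v)) n : ℤ)) =
        ({c | c ∈ coeffLattice v ∧ (∀ i, 0 ≤ c i) ∧ ∑ i, c i = n}.ncard : ℤ) := by
      split_ifs with hn
      · subst hn
        have : {c | c ∈ coeffLattice v ∧ (∀ i, 0 ≤ c i) ∧ ∑ i, c i = ((0 : ℕ) : ℝ)} = {0} := by
          ext c
          simp only [Set.mem_ofPred_eq, Set.mem_singleton_iff]
          constructor
          · rintro ⟨-, h2, h3⟩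
            funext i
            exact (Finset.sum_eq_zero_iff_of_nonneg fun i _ => h2 i).1 (by simpa using h3) i
              (Finset.mem_univ i)
          · rintro rfl
            exact ⟨zero_mem _, by simp, by simp⟩
        rw [this]
        simp
      · rw [ehrhartCount, latticePts_inter_smul_convexHull, Set.InjOn.ncard_image]
        intro b hb c hc h
        refine eq_of_affineIndependent hv (hb.2.2.trans hc.2.2.symm) fun j => ?_
        simpa using congrFun h j
    rw [ehrhartSeries, PowerSeries.coeff_mk, h1, ncard_coeffLattice_eq hv hvl, Finset.sum_mul,
      map_sum]
    push_cast
    refine Finset.sum_congr rfl fun c _ => ?_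
    rw [PowerSeries.coeff_X_pow_mul']
    simp
  rw [key, mul_comm, mul_assoc]
  have := PowerSeries.mk_add_choose_mul_one_sub_pow_eq_one ℤ d
  rw [this, mul_one]

lemma coeff_sum_X_pow (s : Multiset ℕ) (n : ℕ) :
    PowerSeries.coeff n (s.map fun k => (PowerSeries.X : PowerSeries ℤ) ^ k).sum = s.count n := by
  induction s using Multiset.induction_on with
  | empty => simp
  | cons a s ih =>
    rw [Multiset.map_cons, Multiset.sum_cons, map_add, ih, PowerSeries.coeff_X_pow,
      Multiset.count_cons]
    push_cast
    ring

/-- The heights of the elements of `Λ` are the exponents of the δ-polynomial. -/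
lemma map_height_eq {d i1 i2 i3 : ℕ} {v : Fin (d + 1) → Fin d → ℝ}
    (hv : AffineIndependent ℝ v) (hvl : ∀ i, v i ∈ latticePts d)
    (hδ : HasDeltaPoly (convexHull ℝ (Set.range v)) (1 + X ^ i1 + X ^ i2 + X ^ i3)) :
    (finite_simplexLambda hv).toFinset.val.map height = {0, i1, i2, i3} := by
  rw [HasDeltaPoly, one_sub_X_pow_mul_ehrhartSeries hv hvl] at hδ
  have h1 : (((finite_simplexLambda hv).toFinset.val.map height).map
      fun k => (PowerSeries.X : PowerSeries ℤ) ^ k).sum =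
      (({0, i1, i2, i3} : Multiset ℕ).map fun k => (PowerSeries.X : PowerSeries ℤ) ^ k).sum := by
    rw [Multiset.map_map]
    refine Eq.trans hδ ?_
    simp [add_assoc]
  ext n
  have := congrArg (PowerSeries.coeff n) h1
  rw [coeff_sum_X_pow, coeff_sum_X_pow] at this
  exact_mod_cast this

/-- The affine basis formed by the vertices of a full-dimensional simplex. -/
def vertexBasis {d : ℕ} {v : Fin (d + 1) → Fin d → ℝ} (hv : AffineIndependent ℝ v) :
    AffineBasis (Fin (d + 1)) ℝ (Fin d → ℝ) :=
  ⟨v, hv, (hv.affineSpan_eq_top_iff_card_eq_finrank_add_one).2 (by simp)⟩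

lemma vertexBasis_apply {d : ℕ} {v : Fin (d + 1) → Fin d → ℝ} (hv : AffineIndependent ℝ v)
    (i : Fin (d + 1)) : vertexBasis hv i = v i := rfl

lemma sum_coords_mul {d : ℕ} {v : Fin (d + 1) → Fin d → ℝ} (hv : AffineIndependent ℝ v)
    (x : Fin d → ℝ) (j : Fin d) : ∑ i, (vertexBasis hv).coords x i * v i j = x j := by
  have := congrFun ((vertexBasis hv).linear_combination_coord_eq_self x) j
  simpa [vertexBasis_apply] using this

lemma sum_coords {d : ℕ} {v : Fin (d + 1) → Fin d → ℝ} (hv : AffineIndependent ℝ v)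
    (x : Fin d → ℝ) : ∑ i, (vertexBasis hv).coords x i = 1 :=
  (vertexBasis hv).sum_coord_apply_eq_one x

lemma coords_mem_coeffLattice {d : ℕ} {v : Fin (d + 1) → Fin d → ℝ}
    (hv : AffineIndependent ℝ v) {x : Fin d → ℝ} (hx : x ∈ latticePts d) :
    (vertexBasis hv).coords x ∈ coeffLattice v := by
  refine ⟨fun j => ?_, ?_⟩
  · rw [sum_coords_mul]
    exact mem_latticePts.1 hx j
  · rw [sum_coords]
    exact one_mem _

/-- Simplices with the same coefficient lattice are unimodularly equivalent. -/
lemma unimodEquiv_of_coeffLattice_eq {d : ℕ} {v w : Fin (d + 1) → Fin d → ℝ}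
    (hv : AffineIndependent ℝ v) (hw : AffineIndependent ℝ w)
    (h : coeffLattice v = coeffLattice w) :
    UnimodEquiv (convexHull ℝ (Set.range v)) (convexHull ℝ (Set.range w)) := by
  have htop : ∀ {u : Fin (d + 1) → Fin d → ℝ}, AffineIndependent ℝ u →
      affineSpan ℝ (convexHull ℝ (Set.range u)) = ⊤ := fun hu => by
    rw [affineSpan_convexHull]
    exact (vertexBasis hu).tot
  refine ⟨(Fintype.linearCombination ℝ w).toAffineMap.comp (vertexBasis hv).coords, ?_, ?_⟩
  · rw [htop hv, htop hw]
    simp only [AffineSubspace.top_coe, Set.inter_univ]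
    have hf : ∀ x j, (Fintype.linearCombination ℝ w).toAffineMap.comp (vertexBasis hv).coords x j =
        ∑ i, (vertexBasis hv).coords x i * w i j := fun x j => by
      simp [Fintype.linearCombination_apply]
    refine ⟨fun x hx => ?_, fun x _ y _ hxy => ?_, fun y hy => ?_⟩
    · rw [mem_latticePts]
      intro j
      rw [hf]
      have := coords_mem_coeffLattice hv hx
      rw [h] at this
      exact this.1 j
    · have h1 : (vertexBasis hv).coords x = (vertexBasis hv).coords y := by
        refine eq_of_affineIndependent hw (by rw [sum_coords, sum_coords]) fun j => ?_
        rw [← hf, ← hf, hxy]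
      funext j
      rw [← sum_coords_mul hv x, ← sum_coords_mul hv y, h1]
    · have h1 := coords_mem_coeffLattice hw hy
      rw [← h] at h1
      refine ⟨fun j => ∑ i, (vertexBasis hw).coords y i * v i j, mem_latticePts.2 h1.1, ?_⟩
      have h2 : (vertexBasis hv).coords (fun j => ∑ i, (vertexBasis hw).coords y i * v i j) =
          (vertexBasis hw).coords y := by
        refine eq_of_affineIndependent hv (by rw [sum_coords, sum_coords]) fun j => ?_
        rw [sum_coords_mul]
      funext j
      rw [hf, h2, sum_coords_mul]
  · rw [AffineMap.image_convexHull, ← Set.range_comp]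
    congr 2
    funext i
    funext j
    have h1 : (vertexBasis hv).coords (v i) = Pi.single i 1 := by
      refine eq_of_affineIndependent hv (by rw [sum_coords]; simp) fun j => ?_
      rw [sum_coords_mul]
      simp [Pi.single_apply]
    simp [h1]

lemma pyramidOver_convexHull_range {n : ℕ} {w : Fin (n + 2) → Fin (n + 1) → ℝ} {i : Fin (n + 2)}
    (hi : w i = Fin.snoc (0 : Fin n → ℝ) (1 : ℝ))
    (hne : ∀ k, w (i.succAbove k) (Fin.last n) = 0) :
    pyramidOver (convexHull ℝ (Set.range fun k l => w (i.succAbove k) (Fin.castSucc l))) =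
      convexHull ℝ (Set.range w) := by
  have hlin : IsLinearMap ℝ (fun x : Fin n → ℝ => (Fin.snoc x (0 : ℝ) : Fin (n + 1) → ℝ)) := by
    constructor
    · intro x y
      funext k
      refine Fin.lastCases ?_ (fun k => ?_) k <;> simp
    · intro c x
      funext k
      refine Fin.lastCases ?_ (fun k => ?_) k <;> simp
  rw [pyramidOver, hlin.image_convexHull, convexHull_convexHull_union_left, ← Set.range_comp]
  have hs : ∀ k, (Fin.snoc (fun l => w (i.succAbove k) (Fin.castSucc l)) (0 : ℝ) :
      Fin (n + 1) → ℝ) = w (i.succAbove k) := by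
    intro k
    funext l
    refine Fin.lastCases ?_ (fun l => ?_) l
    · simp [hne]
    · simp
  congr 1
  ext x
  simp only [Set.mem_union, Set.mem_range, Function.comp, hs, Set.mem_singleton_iff, ← hi]
  constructor
  · rintro (⟨k, rfl⟩ | rfl) <;> exact ⟨_, rfl⟩
  · rintro ⟨k, rfl⟩
    rcases Fin.eq_self_or_eq_succAbove i k with rfl | ⟨l, rfl⟩
    · exact Or.inr rfl
    · exact Or.inl ⟨l, rfl⟩

lemma affineIndependent_succAbove {n : ℕ} {w : Fin (n + 2) → Fin (n + 1) → ℝ} {i : Fin (n + 2)}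
    (hw : AffineIndependent ℝ w) (hne : ∀ k, w (i.succAbove k) (Fin.last n) = 0) :
    AffineIndependent ℝ fun k (l : Fin n) => w (i.succAbove k) (Fin.castSucc l) := by
  refine affineIndependent_of_forall fun c hc hc' k => ?_
  have h0 : (i.insertNth 0 c : Fin (n + 2) → ℝ) = 0 := by
    refine eq_of_affineIndependent hw ?_ fun j => ?_
    · simp [Fin.sum_univ_succAbove _ i, hc]
    · refine Fin.lastCases ?_ (fun l => ?_) j
      · simp [Fin.sum_univ_succAbove _ i, hne]
      · simp [Fin.sum_univ_succAbove _ i, hc']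
  simpa using congrFun h0 (i.succAbove k)

/-- A simplex with a vertex whose coefficient is always integral is a lattice pyramid. -/
lemma isLatticePyramid_of_forall_coeff_int {d : ℕ} (hd : 0 < d) {v : Fin (d + 1) → Fin d → ℝ}
    (hv : AffineIndependent ℝ v) (hvl : ∀ i, v i ∈ latticePts d) (i : Fin (d + 1))
    (hi : ∀ c ∈ coeffLattice v, c i ∈ intReals) :
    IsLatticePyramid (convexHull ℝ (Set.range v)) := by
  choose V hV using hvl
  have hvl : ∀ i, v i ∈ latticePts d := fun i j => ⟨V i j, hV i j⟩
  obtain ⟨j0, hj0⟩ : ∃ j0, j0 ≠ i := by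
    have : Nontrivial (Fin (d + 1)) := Fin.nontrivial_iff_two_le.2 (by omega)
    exact exists_ne i
  set f := (vertexBasis hv).coord i with hf
  have hfv : ∀ k, f (v k) = if i = k then 1 else 0 := fun k => (vertexBasis hv).coord_apply i k
  have hlin : ∀ x : Fin d → ℤ, f.linear (fun j => (x j : ℝ)) ∈ intReals := by
    intro x
    have h1 : f ((fun j => (x j : ℝ)) +ᵥ v j0) = f.linear (fun j => (x j : ℝ)) +ᵥ f (v j0) :=
      f.map_vadd _ _
    rw [hfv, if_neg hj0.symm, vadd_eq_add, vadd_eq_add, add_zero] at h1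
    rw [← h1]
    refine hi _ (coords_mem_coeffLattice hv (mem_latticePts.2 fun j => ?_))
    exact add_mem (intCast_mem_intReals _) (mem_latticePts.1 (hvl j0) j)
  choose U hU using fun j : Fin d => mem_intReals.1 (hlin (Pi.single j 1))
  set u : (Fin d → ℤ) →ₗ[ℤ] ℤ := Fintype.linearCombination ℤ U with hu
  have huf : ∀ x : Fin d → ℤ, (u x : ℝ) = f.linear (fun j => (x j : ℝ)) := by
    intro x
    rw [LinearMap.pi_apply_eq_sum_univ f.linear]
    simp only [hu, Fintype.linearCombination_apply, smul_eq_mul]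
    push_cast
    refine Finset.sum_congr rfl fun j _ => ?_
    rw [← hU j]
    congr 2
    funext k
    simp [Pi.single_apply, eq_comm]
  have huV : ∀ k, u (V k - V j0) = if i = k then 1 else 0 := by
    intro k
    have h1 : (u (V k - V j0) : ℝ) = f (v k) - f (v j0) := by
      rw [huf, ← vsub_eq_sub (f (v k)), ← f.linearMap_vsub]
      congr 1
      funext j
      simp [hV]
    rw [hfv, hfv, if_neg hj0.symm, sub_zero] at h1
    split_ifs at h1 ⊢ <;> exact_mod_cast h1
  obtain ⟨n, b⟩ := Submodule.basisOfPid (Pi.basisFun ℤ (Fin d)) (LinearMap.ker u)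
  have hy : u (V i - V j0) = 1 := by simp [huV]
  set B := (Module.Basis.mkFinCons (V i - V j0) b (fun c x hx h => by
      have := congrArg u h
      rw [map_add, map_smul, hy, LinearMap.mem_ker.1 hx] at this
      simpa using this) (fun z => ⟨-u z, by
      rw [LinearMap.mem_ker, map_add, map_smul, hy]
      simp⟩)).reindex (finRotate (n + 1)).symm with hB
  have hBlast : B (Fin.last n) = V i - V j0 := by
    rw [hB, Module.Basis.reindex_apply]
    simp
  have hBne : ∀ k, k ≠ Fin.last n → u (B k) = 0 := by
    intro k hk
    rw [hB, Module.Basis.reindex_apply]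
    simp only [Equiv.symm_symm, Module.Basis.coe_mkFinCons]
    have h1 : finRotate (n + 1) k ≠ 0 := fun h => hk (by
      rw [← finRotate_last] at h
      exact (finRotate (n + 1)).injective h)
    obtain ⟨l, hl⟩ := Fin.exists_succ_eq.2 h1
    rw [← hl]
    simp
  have hrepr : ∀ x, B.repr x (Fin.last n) = u x := by
    intro x
    have : B.coord (Fin.last n) = u := B.ext fun k => by
      by_cases hk : k = Fin.last n
      · subst hk
        rw [hBlast, hy, ← hBlast]
        simp
      · rw [hBne k hk]
        simp [hk]
    rw [← this]
    rfl
  have hdn : d = n + 1 := by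
    have := Module.finrank_eq_card_basis B
    simpa using this
  subst hdn
  set w : Fin (n + 2) → Fin (n + 1) → ℝ := fun k l => (B.repr (V k - V j0) l : ℝ) with hw
  have hwi : w i = Fin.snoc (0 : Fin n → ℝ) (1 : ℝ) := by
    funext l
    simp only [hw, ← hBlast, Module.Basis.repr_self]
    refine Fin.lastCases ?_ (fun l => ?_) l
    · simp
    · simp
  have hwne : ∀ k, w (i.succAbove k) (Fin.last n) = 0 := by
    intro k
    simp only [hw, hrepr, huV]
    simp [(Fin.succAbove_ne i k).symm]
  have hvw : ∀ (c : Fin (n + 2) → ℝ) j, ∑ k, c k * v k j =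
      ∑ l, (∑ k, c k * w k l) * (B l j : ℝ) + (∑ k, c k) * v j0 j := by
    intro c j
    have h1 : ∀ k, v k j = ∑ l, w k l * (B l j : ℝ) + v j0 j := by
      intro k
      have h2 := congrFun (B.sum_repr (V k - V j0)) j
      simp only [Finset.sum_apply, Pi.smul_apply, smul_eq_mul, Pi.sub_apply] at h2
      rw [hV k, hV j0]
      have h3 : ((∑ l, B.repr (V k - V j0) l * B l j : ℤ) : ℝ) = (V k j - V j0 j : ℤ) := by
        rw [h2]
      push_cast at h3
      change _ = ∑ l, (B.repr (V k - V j0) l : ℝ) * (B l j : ℝ) + _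
      rw [h3, sub_add_cancel]
    rw [Finset.sum_congr rfl fun k _ => congrArg (c k * ·) (h1 k)]
    simp_rw [mul_add, Finset.sum_add_distrib, Finset.sum_mul, Finset.mul_sum]
    rw [Finset.sum_comm]
    simp only [mul_assoc]
  have hwv : ∀ (c : Fin (n + 2) → ℝ) l, ∑ k, c k * w k l =
      ∑ j, (∑ k, c k * v k j - (∑ k, c k) * v j0 j) * (B.repr (Pi.single j 1) l : ℝ) := by
    intro c l
    have h1 : ∀ k, w k l = ∑ j, (v k j - v j0 j) * (B.repr (Pi.single j 1) l : ℝ) := by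
      intro k
      have h2 := LinearMap.pi_apply_eq_sum_univ (B.coord l) (V k - V j0)
      simp only [Module.Basis.coord_apply, Pi.sub_apply, smul_eq_mul] at h2
      simp only [hw]
      rw [h2]
      push_cast
      refine Finset.sum_congr rfl fun j _ => ?_
      rw [hV k, hV j0]
      congr 4
      funext m
      simp [Pi.single_apply, eq_comm]
    simp_rw [h1, Finset.mul_sum, Finset.sum_mul, ← Finset.sum_sub_distrib]
    rw [Finset.sum_comm]
    refine Finset.sum_congr rfl fun j _ => ?_
    rw [Finset.sum_mul]
    refine Finset.sum_congr rfl fun k _ => ?_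
    ring
  have hwind : AffineIndependent ℝ w := by
    refine affineIndependent_of_forall fun c hc hc' k => ?_
    have : c = 0 := eq_of_affineIndependent hv (by simpa using hc) fun j => by
      rw [hvw, hc]
      simp [hc']
    rw [this]
    rfl
  have hL : coeffLattice v = coeffLattice w := by
    ext c
    constructor
    · rintro ⟨h1, h2⟩
      refine ⟨fun l => ?_, h2⟩
      rw [hwv]
      exact sum_mem fun j _ => mul_mem (sub_mem (h1 j) (mul_mem h2 (mem_latticePts.1 (hvl j0) j)))
        (intCast_mem_intReals _)
    · rintro ⟨h1, h2⟩
      refine ⟨fun l => ?_, h2⟩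
      rw [hvw]
      exact add_mem (sum_mem fun j _ => mul_mem (h1 j) (intCast_mem_intReals _))
        (mul_mem h2 (mem_latticePts.1 (hvl j0) l))
  refine ⟨n, convexHull ℝ (Set.range fun k l => w (i.succAbove k) (Fin.castSucc l)), ?_, ?_, ?_⟩
  · classical
    refine ⟨Finset.univ.image fun k l => w (i.succAbove k) (Fin.castSucc l), ?_, by simp⟩
    intro x hx
    simp only [Finset.coe_image, Finset.coe_univ, Set.image_univ, Set.mem_range] at hx
    obtain ⟨k, rfl⟩ := hx
    exact fun l => ⟨_, rfl⟩
  · rw [affineSpan_convexHull]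
    exact (vertexBasis (affineIndependent_succAbove hwind hwne)).tot
  · rw [pyramidOver_convexHull_range hwi hwne]
    exact unimodEquiv_of_coeffLattice_eq hv hwind hL

lemma card_mul_mem_intReals {d : ℕ} {v : Fin (d + 1) → Fin d → ℝ}
    (hv : AffineIndependent ℝ v) (hvl : ∀ i, v i ∈ latticePts d) {g : Fin (d + 1) → ℝ}
    (hg : g ∈ simplexLambda v) (i : Fin (d + 1)) :
    ((finite_simplexLambda hv).toFinset.card : ℝ) * g i ∈ intReals := by
  set Λ := (finite_simplexLambda hv).toFinset with hΛ
  have hmem : ∀ c, c ∈ Λ ↔ c ∈ simplexLambda v := fun c => by simp [hΛ]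
  set s : (Fin (d + 1) → ℝ) → Fin (d + 1) → ℝ := fun c i => Int.fract (c i + g i) with hs
  have hmaps : Set.MapsTo s Λ Λ := fun c hc => by
    rw [Finset.mem_coe, hmem] at hc ⊢
    exact fract_mem_simplexLambda hvl
      (add_mem (mem_simplexLambda.1 hc).1 (mem_simplexLambda.1 hg).1)
  have hinj : Set.InjOn s Λ := fun b hb c hc h => by
    rw [Finset.mem_coe, hmem, mem_simplexLambda] at hb hc
    funext j
    refine eq_of_sub_mem_intReals (hb.2 j) (hc.2 j) ?_
    have h1 := congrFun h j
    simp only [hs] at h1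
    have h2 := sub_mem (fract_sub_mem_intReals (c j + g j)) (fract_sub_mem_intReals (b j + g j))
    rw [h1] at h2
    convert h2 using 1
    ring
  have himg : Λ.image s = Λ := Finset.eq_of_subset_of_card_le
    (Finset.image_subset_iff.2 hmaps) (Finset.card_image_of_injOn hinj).ge
  have hsum : ∑ c ∈ Λ, s c i = ∑ c ∈ Λ, c i := by
    conv_rhs => rw [← himg, Finset.sum_image hinj]
  have h1 : ∑ c ∈ Λ, (s c i - (c i + g i)) ∈ intReals :=
    sum_mem fun c _ => fract_sub_mem_intReals _
  rw [Finset.sum_sub_distrib, hsum, Finset.sum_add_distrib, Finset.sum_const, nsmul_eq_mul] at h1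
  convert neg_mem h1 using 1
  ring

/-- The coefficient lattice is generated over the integral vectors by `α / 4`. -/
def IsCyclicLattice {d : ℕ} (v : Fin (d + 1) → Fin d → ℝ) (α : Fin (d + 1) → ℤ) : Prop :=
  ∀ c, c ∈ coeffLattice v ↔ ∃ k : ℤ, ∀ i, c i - k * α i / 4 ∈ intReals

/-- The coefficient lattice is generated over the integral vectors by `α / 2` and `β / 2`. -/
def IsKleinLattice {d : ℕ} (v : Fin (d + 1) → Fin d → ℝ) (α β : Fin (d + 1) → ℤ) : Prop :=
  ∀ c, c ∈ coeffLattice v ↔ ∃ k l : ℤ, ∀ i, c i - (k * α i + l * β i) / 2 ∈ intReals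

lemma emod_div_sub_mem_intReals (a : ℤ) {m : ℤ} (hm : m ≠ 0) :
    ((a % m : ℤ) : ℝ) / m - a / m ∈ intReals := by
  refine mem_intReals.2 ⟨-(a / m), ?_⟩
  have h : ((a % m + m * (a / m) : ℤ) : ℝ) = (a : ℤ) := by rw [Int.emod_add_mul_ediv]
  have hm' : (m : ℝ) ≠ 0 := by exact_mod_cast hm
  push_cast at h ⊢
  rw [← h]
  field_simp
  ring

lemma emod_div_mem_simplexLambda {d : ℕ} {v : Fin (d + 1) → Fin d → ℝ}
    (hvl : ∀ i, v i ∈ latticePts d) {m : ℤ} (hm : 0 < m) {γ : Fin (d + 1) → ℤ}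
    (h : (fun i => (γ i : ℝ) / m) ∈ coeffLattice v) :
    (fun i => ((γ i % m : ℤ) : ℝ) / m) ∈ simplexLambda v := by
  have hm' : (0 : ℝ) < m := by exact_mod_cast hm
  refine mem_simplexLambda.2 ⟨(mem_coeffLattice_iff_of_sub hvl fun i =>
    emod_div_sub_mem_intReals _ hm.ne').2 h, fun i => ⟨?_, ?_⟩⟩
  · exact div_nonneg (by exact_mod_cast Int.emod_nonneg _ hm.ne') hm'.le
  · rw [div_lt_one hm']
    exact_mod_cast Int.emod_lt_of_pos _ hm

lemma height_div {d : ℕ} {v : Fin (d + 1) → Fin d → ℝ} {m : ℤ} (hm : 0 < m)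
    {γ : Fin (d + 1) → ℤ} (h : (fun i => (γ i : ℝ) / m) ∈ simplexLambda v) :
    ∑ i, γ i = m * height fun i => (γ i : ℝ) / m := by
  have hm' : (0 : ℝ) < m := by exact_mod_cast hm
  have h1 := height_eq h
  rw [← Finset.sum_div, eq_div_iff hm'.ne'] at h1
  have : ((∑ i, γ i : ℤ) : ℝ) = (m * height fun i => (γ i : ℝ) / m : ℤ) := by
    push_cast
    rw [← h1]
    ring
  exact_mod_cast this

lemma exists_isCyclicLattice {d i1 i2 i3 : ℕ} {v : Fin (d + 1) → Fin d → ℝ}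
    (hv : AffineIndependent ℝ v) (hvl : ∀ i, v i ∈ latticePts d)
    (hht : (finite_simplexLambda hv).toFinset.val.map height = {0, i1, i2, i3})
    (hex : ∃ g ∈ simplexLambda v, ∃ i, 2 * g i ∉ intReals) :
    ∃ (α : Fin (d + 1) → ℤ) (p q r : ℕ), (∀ i, 0 ≤ α i ∧ α i < 4) ∧ IsCyclicLattice v α ∧
      ({p, q, r} : Multiset ℕ) = {i1, i2, i3} ∧ p ≤ r ∧ ∑ i, α i = 4 * p ∧
      ∑ i, (2 * α i) % 4 = 4 * q ∧ ∑ i, (3 * α i) % 4 = 4 * r := by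
  classical
  set Λ := (finite_simplexLambda hv).toFinset with hΛ
  have hmem : ∀ c, c ∈ Λ ↔ c ∈ simplexLambda v := fun c => by simp [hΛ]
  have hcard : Λ.card = 4 := by
    have := congrArg Multiset.card hht
    simpa using this
  obtain ⟨g, hg, hmin⟩ := Finset.exists_min_image (Λ.filter fun g => ∃ i, 2 * g i ∉ intReals)
    height (by
      obtain ⟨g, hg, h⟩ := hex
      exact ⟨g, Finset.mem_filter.2 ⟨(hmem g).2 hg, h⟩⟩)
  obtain ⟨hgΛ, i0, hi0⟩ := Finset.mem_filter.1 hg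
  rw [hmem] at hgΛ
  have hg' := mem_simplexLambda.1 hgΛ
  have h4 : ∀ i, ∃ z : ℤ, 4 * g i = z := fun i => by
    have := card_mul_mem_intReals hv hvl hgΛ i
    rw [← hΛ, hcard] at this
    exact mem_intReals.1 (by exact_mod_cast this)
  choose α hα using h4
  have hgα : ∀ i, g i = α i / 4 := fun i => by rw [← hα]; ring
  have hα4 : ∀ i, 0 ≤ α i ∧ α i < 4 := fun i => by
    have h1 : (0 : ℝ) ≤ α i := by rw [← hα]; linarith [(hg'.2 i).1]
    have h2 : (α i : ℝ) < 4 := by rw [← hα]; linarith [(hg'.2 i).2]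
    exact ⟨by exact_mod_cast h1, by exact_mod_cast h2⟩
  have hodd : α i0 % 2 = 1 := by
    by_contra hne
    refine hi0 (mem_intReals.2 ⟨α i0 / 2, ?_⟩)
    have h1 : α i0 = 2 * (α i0 / 2) := by omega
    have h2 : (α i0 : ℝ) = 2 * ((α i0 / 2 : ℤ) : ℝ) := by exact_mod_cast h1
    rw [hgα, h2]
    ring
  set a : Fin 4 → Fin (d + 1) → ℝ := fun k i => (((k : ℤ) * α i % 4 : ℤ) : ℝ) / (4 : ℤ) with ha
  have haΛ : ∀ k, a k ∈ simplexLambda v := fun k => by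
    refine emod_div_mem_simplexLambda hvl (by norm_num) (γ := fun i => (k : ℤ) * α i) ?_
    convert zsmul_mem hg'.1 (k : ℤ) using 1
    funext i
    simp [hgα]
    ring
  have hinj : Function.Injective a := by
    intro k l hkl
    have h1 := congrFun hkl i0
    simp only [ha] at h1
    rw [div_left_inj' (by norm_num)] at h1
    have h2 : (k : ℤ) * α i0 % 4 = (l : ℤ) * α i0 % 4 := by exact_mod_cast h1
    have h3 : α i0 = 1 ∨ α i0 = 3 := by have := hα4 i0; omega
    have := k.isLt
    have := l.isLt
    refine Fin.ext ?_
    rcases h3 with h3 | h3 <;> rw [h3] at h2 <;> omega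
  have himg : Finset.univ.image a = Λ := by
    refine Finset.eq_of_subset_of_card_le (Finset.image_subset_iff.2 fun k _ =>
      (hmem _).2 (haΛ k)) ?_
    rw [hcard, Finset.card_image_of_injective _ hinj]
    simp
  have hval : (Finset.univ : Finset (Fin 4)).val.map (fun k => height (a k)) = {0, i1, i2, i3} := by
    rw [← hht, ← himg, Finset.image_val_of_injOn hinj.injOn, Multiset.map_map]
    rfl
  have huniv : (Finset.univ : Finset (Fin 4)).val = {0, 1, 2, 3} := by decide
  have hh : ∀ k : Fin 4, ∑ i, ((k : ℤ) * α i) % 4 = 4 * height (a k) := fun k =>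
    height_div (by norm_num) (haΛ k)
  have h0 : height (a 0) = 0 := by
    have := hh 0
    simpa using this.symm
  have h1 : a 1 = g := by
    funext i
    have : α i % 4 = α i := Int.emod_eq_of_lt (hα4 i).1 (hα4 i).2
    simp [ha, hgα, this]
  refine ⟨α, height (a 1), height (a 2), height (a 3), hα4, ?_, ?_, ?_, ?_, hh 2, hh 3⟩
  · intro c
    constructor
    · intro hc
      have h2 := fract_mem_simplexLambda hvl hc
      rw [← hmem, ← himg, Finset.mem_image] at h2
      obtain ⟨k, -, hk⟩ := h2
      refine ⟨k, fun i => ?_⟩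
      have h3 := emod_div_sub_mem_intReals ((k : ℤ) * α i) (m := 4) (by norm_num)
      have h4 : Int.fract (c i) = _ := (congrFun hk i).symm
      have h5 := sub_mem h3 (fract_sub_mem_intReals (c i))
      rw [h4] at h5
      convert h5 using 1
      simp only [ha]
      push_cast
      ring
    · rintro ⟨k, hk⟩
      rw [mem_coeffLattice_iff_of_sub hvl hk]
      convert zsmul_mem hg'.1 k using 1
      funext i
      simp [hgα]
      ring
  · rw [huniv] at hval
    simpa [h0] using hval
  · rw [h1]
    refine hmin _ (Finset.mem_filter.2 ⟨(hmem _).2 (haΛ 3), i0, fun h => ?_⟩)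
    obtain ⟨z, hz⟩ := mem_intReals.1 h
    have h2 : ((3 * α i0 % 4 : ℤ) : ℝ) = (2 * z : ℤ) := by
      simp only [ha] at hz
      push_cast at hz ⊢
      rw [← hz]
      simp
      ring
    have h3 : 3 * α i0 % 4 = 2 * z := by exact_mod_cast h2
    omega
  · rw [← hh 1]
    refine Finset.sum_congr rfl fun i _ => ?_
    have : α i % 4 = α i := Int.emod_eq_of_lt (hα4 i).1 (hα4 i).2
    simp [this]

lemma exists_eq_of_map_eq {β γ : Type*} [DecidableEq β] {s : Multiset β} {f : β → γ}
    {b0 b1 b2 b3 : γ} (h : s.map f = {b0, b1, b2, b3}) :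
    ∃ a0 a1 a2 a3, s = {a0, a1, a2, a3} ∧ f a0 = b0 ∧ f a1 = b1 ∧ f a2 = b2 ∧ f a3 = b3 := by
  obtain ⟨a0, m0, h0, hr⟩ := (Multiset.map_eq_cons _ _ _ _).2 h
  obtain ⟨a1, m1, h1, hr⟩ := (Multiset.map_eq_cons _ _ _ _).2 hr
  obtain ⟨a2, m2, h2, hr⟩ := (Multiset.map_eq_cons _ _ _ _).2 hr
  obtain ⟨a3, h3, hr⟩ := Multiset.map_eq_singleton.1 hr
  refine ⟨a0, a1, a2, a3, ?_, h0, h1, h2, hr⟩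
  rw [← Multiset.cons_erase m0, ← Multiset.cons_erase m1, ← Multiset.cons_erase m2, h3]
  rfl

lemma exists_isKleinLattice {d i1 i2 i3 : ℕ} {v : Fin (d + 1) → Fin d → ℝ}
    (hv : AffineIndependent ℝ v) (hvl : ∀ i, v i ∈ latticePts d)
    (hht : (finite_simplexLambda hv).toFinset.val.map height = {0, i1, i2, i3})
    (hall : ∀ g ∈ simplexLambda v, ∀ i, 2 * g i ∈ intReals) :
    ∃ α β : Fin (d + 1) → ℤ, (∀ i, 0 ≤ α i ∧ α i < 2) ∧ (∀ i, 0 ≤ β i ∧ β i < 2) ∧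
      IsKleinLattice v α β ∧ ∑ i, α i = 2 * i1 ∧ ∑ i, β i = 2 * i2 ∧
      ∑ i, (α i + β i) % 2 = 2 * i3 := by
  classical
  set Λ := (finite_simplexLambda hv).toFinset with hΛ
  have hmem : ∀ c, c ∈ Λ ↔ c ∈ simplexLambda v := fun c => by simp [hΛ]
  obtain ⟨a0, a1, a2, a3, hval, h0, h1, h2, h3⟩ := exists_eq_of_map_eq hht
  have hmem' : ∀ c, c ∈ simplexLambda v ↔ c = a0 ∨ c = a1 ∨ c = a2 ∨ c = a3 := fun c => by
    rw [← hmem, ← Finset.mem_val, hval]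
    simp
  have hnd : a0 ≠ a1 ∧ a0 ≠ a2 ∧ a1 ≠ a2 := by
    have := Λ.nodup
    rw [hval] at this
    simp only [Multiset.insert_eq_cons, Multiset.nodup_cons, Multiset.mem_cons] at this
    tauto
  obtain ⟨hn1, hn2, hn12⟩ := hnd
  have ha0 : a0 = 0 := by
    have h := height_eq ((hmem' a0).2 (Or.inl rfl))
    rw [h0, Nat.cast_zero] at h
    funext i
    exact (Finset.sum_eq_zero_iff_of_nonneg fun i _ =>
      ((mem_simplexLambda.1 ((hmem' a0).2 (Or.inl rfl))).2 i).1).1 h.symm i (Finset.mem_univ i)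
  subst ha0
  have hnum : ∀ g ∈ simplexLambda v, ∃ γ : Fin (d + 1) → ℤ, (∀ i, 0 ≤ γ i ∧ γ i < 2) ∧
      (fun i => (γ i : ℝ) / (2 : ℤ)) = g := fun g hg => by
    choose γ hγ using fun i => mem_intReals.1 (hall g hg i)
    refine ⟨γ, fun i => ?_, funext fun i => by rw [← hγ]; push_cast; ring⟩
    have h := (mem_simplexLambda.1 hg).2 i
    have h1 : (0 : ℝ) ≤ γ i := by rw [← hγ]; linarith [h.1]
    have h2 : (γ i : ℝ) < 2 := by rw [← hγ]; linarith [h.2]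
    exact ⟨by exact_mod_cast h1, by exact_mod_cast h2⟩
  have m1 : a1 ∈ simplexLambda v := (hmem' a1).2 (by simp)
  have m2 : a2 ∈ simplexLambda v := (hmem' a2).2 (by simp)
  obtain ⟨α, hα, rfl⟩ := hnum a1 m1
  obtain ⟨β, hβ, rfl⟩ := hnum a2 m2
  have hmod : ∀ x : ℤ, 0 ≤ x ∧ x < 2 → x = 0 ∨ x = 1 := fun x hx => by omega
  have m12 : (fun i => (((α i + β i) % 2 : ℤ) : ℝ) / (2 : ℤ)) ∈ simplexLambda v := by
    refine emod_div_mem_simplexLambda hvl (by norm_num) (γ := fun i => α i + β i) ?_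
    convert add_mem (mem_simplexLambda.1 m1).1 (mem_simplexLambda.1 m2).1 using 1
    funext i
    simp
    ring
  have hext : ∀ γ δ : Fin (d + 1) → ℤ, (fun i => (γ i : ℝ) / (2 : ℤ)) =
      (fun i => (δ i : ℝ) / (2 : ℤ)) → ∀ i, γ i = δ i := fun γ δ h i => by
    have := congrFun h i
    rw [div_left_inj' (by norm_num)] at this
    exact_mod_cast this
  have h12 : (fun i => (((α i + β i) % 2 : ℤ) : ℝ) / (2 : ℤ)) = a3 := by
    rcases (hmem' _).1 m12 with h | h | h | h
    · refine absurd (_root_.funext fun i => ?_) hn12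
      have := hext (fun i => (α i + β i) % 2) (fun _ => 0) (h.trans (by funext i; simp)) i
      have hi := hα i
      have hi' := hβ i
      have : α i = β i := by omega
      rw [this]
    · refine absurd (_root_.funext fun i => ?_) hn2
      have := hext (fun i => (α i + β i) % 2) α h i
      have hi := hα i
      have hi' := hβ i
      have : β i = 0 := by omega
      simp [this]
    · refine absurd (_root_.funext fun i => ?_) hn1
      have := hext (fun i => (α i + β i) % 2) β h i
      have hi := hα i
      have hi' := hβ i
      have : α i = 0 := by omega
      simp [this]
    · exact h
  have h2r : ((2 : ℤ) : ℝ) = 2 := by norm_num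
  refine ⟨α, β, hα, hβ, fun c => ⟨fun hc => ?_, ?_⟩, ?_, ?_, ?_⟩
  · have h : ∃ k l : ℤ, ∀ i, Int.fract (c i) - (k * α i + l * β i) / 2 ∈ intReals := by
      rcases (hmem' _).1 (fract_mem_simplexLambda hvl hc) with h | h | h | h
      · refine ⟨0, 0, fun i => ?_⟩
        have hi : Int.fract (c i) = _ := congrFun h i
        simp [hi]
      · refine ⟨1, 0, fun i => ?_⟩
        have hi : Int.fract (c i) = _ := congrFun h i
        simp [hi]
      · refine ⟨0, 1, fun i => ?_⟩
        have hi : Int.fract (c i) = _ := congrFun h i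
        simp [hi]
      · refine ⟨1, 1, fun i => ?_⟩
        have hi : Int.fract (c i) = _ := congrFun (h.trans h12.symm) i
        rw [hi]
        have := emod_div_sub_mem_intReals (α i + β i) (m := 2) (by norm_num)
        push_cast at this ⊢
        simpa using this
    obtain ⟨k, l, h⟩ := h
    refine ⟨k, l, fun i => ?_⟩
    convert sub_mem (h i) (fract_sub_mem_intReals (c i)) using 1
    ring
  · rintro ⟨k, l, h⟩
    rw [mem_coeffLattice_iff_of_sub hvl h]
    convert add_mem (zsmul_mem (mem_simplexLambda.1 m1).1 k)
      (zsmul_mem (mem_simplexLambda.1 m2).1 l) using 1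
    funext i
    simp
    ring
  · rw [← h1]
    exact height_div (by norm_num) m1
  · rw [← h2]
    exact height_div (by norm_num) m2
  · rw [← h3, ← h12]
    exact height_div (by norm_num) m12

lemma coeffLattice_comp_perm {d : ℕ} (w : Fin (d + 1) → Fin d → ℝ)
    (σ : Equiv.Perm (Fin (d + 1))) (c : Fin (d + 1) → ℝ) :
    c ∈ coeffLattice (w ∘ σ) ↔ c ∘ σ.symm ∈ coeffLattice w := by
  simp only [mem_coeffLattice, Function.comp]
  have h1 : ∀ j, ∑ i, c (σ.symm i) * w i j = ∑ i, c i * w (σ i) j := fun j => by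
    rw [← Equiv.sum_comp σ]
    simp
  have h2 : ∑ i, c (σ.symm i) = ∑ i, c i := Equiv.sum_comp σ.symm c
  simp only [h1, h2]

lemma unimodEquiv_of_isCyclicLattice {d : ℕ} {v w : Fin (d + 1) → Fin d → ℝ}
    (hv : AffineIndependent ℝ v) (hw : AffineIndependent ℝ w) {α β : Fin (d + 1) → ℤ}
    (hα : IsCyclicLattice v α) (hβ : IsCyclicLattice w β) (σ : Equiv.Perm (Fin (d + 1)))
    (hσ : ∀ i, β (σ i) = α i) :
    UnimodEquiv (convexHull ℝ (Set.range v)) (convexHull ℝ (Set.range w)) := by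
  rw [← σ.surjective.range_comp w]
  refine unimodEquiv_of_coeffLattice_eq hv (hw.comp_embedding σ.toEmbedding) ?_
  ext c
  rw [coeffLattice_comp_perm, hα, hβ]
  refine exists_congr fun k => ?_
  rw [← σ.forall_congr_right (q := fun i => (c ∘ σ.symm) i - k * β i / 4 ∈ intReals)]
  simp [hσ]

lemma unimodEquiv_of_isKleinLattice {d : ℕ} {v w : Fin (d + 1) → Fin d → ℝ}
    (hv : AffineIndependent ℝ v) (hw : AffineIndependent ℝ w) {α β α' β' : Fin (d + 1) → ℤ}
    (hα : IsKleinLattice v α β) (hβ : IsKleinLattice w α' β') (σ : Equiv.Perm (Fin (d + 1)))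
    (hσ : ∀ i, α' (σ i) = α i) (hσ' : ∀ i, β' (σ i) = β i) :
    UnimodEquiv (convexHull ℝ (Set.range v)) (convexHull ℝ (Set.range w)) := by
  rw [← σ.surjective.range_comp w]
  refine unimodEquiv_of_coeffLattice_eq hv (hw.comp_embedding σ.toEmbedding) ?_
  ext c
  rw [coeffLattice_comp_perm, hα, hβ]
  refine exists_congr fun k => exists_congr fun l => ?_
  rw [← σ.forall_congr_right (q := fun i => (c ∘ σ.symm) i - (k * α' i + l * β' i) / 2 ∈ intReals)]
  simp [hσ, hσ']

lemma sum_eq_of_values {n : ℕ} {f : Fin n → ℤ} (hf : ∀ i, f i = 1 ∨ f i = 2 ∨ f i = 3)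
    (F : ℤ → ℤ) : ∑ i, F (f i) = F 1 * (Finset.univ.filter fun i => f i = 1).card +
      F 2 * (Finset.univ.filter fun i => f i = 2).card +
      F 3 * (Finset.univ.filter fun i => f i = 3).card := by
  simp only [Finset.card_filter]
  push_cast
  simp only [Finset.mul_sum, ← Finset.sum_add_distrib]
  refine Finset.sum_congr rfl fun i _ => ?_
  rcases hf i with h | h | h <;> simp [h]

lemma exists_perm_of_card_eq {n : ℕ} {f g : Fin n → ℤ} (hf : ∀ i, f i = 1 ∨ f i = 2 ∨ f i = 3)
    (hg : ∀ i, g i = 1 ∨ g i = 2 ∨ g i = 3)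
    (h2 : (Finset.univ.filter fun i => f i = 2).card = (Finset.univ.filter fun i => g i = 2).card)
    (h3 : (Finset.univ.filter fun i => f i = 3).card = (Finset.univ.filter fun i => g i = 3).card) :
    ∃ σ : Equiv.Perm (Fin n), ∀ i, g (σ i) = f i := by
  have h1 : (Finset.univ.filter fun i => f i = 1).card =
      (Finset.univ.filter fun i => g i = 1).card := by
    have hf1 := sum_eq_of_values hf fun _ => 1
    have hg1 := sum_eq_of_values hg fun _ => 1
    simp only [Finset.sum_const, Finset.card_univ, Fintype.card_fin, one_mul] at hf1 hg1
    omega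
  have h : ∀ c, Fintype.card {i // f i = c} = Fintype.card {i // g i = c} := by
    intro c
    rw [Fintype.card_subtype, Fintype.card_subtype]
    by_cases hc1 : c = 1
    · rw [hc1, h1]
    by_cases hc2 : c = 2
    · rw [hc2, h2]
    by_cases hc3 : c = 3
    · rw [hc3, h3]
    rw [Finset.filter_false_of_mem, Finset.filter_false_of_mem]
    · intro i _
      have := hg i
      omega
    · intro i _
      have := hf i
      omega
  exact ⟨Equiv.ofFiberEquiv fun c => Fintype.equivOfCardEq (h c),
    fun i => Equiv.ofFiberEquiv_map _ i⟩

lemma card_filter_fin (n : ℕ) (p : ℕ → Prop) [DecidablePred p] :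
    (Finset.univ.filter fun i : Fin n => p i).card = ((Finset.range n).filter p).card := by
  simp only [Finset.card_filter, Finset.sum_range]

/-- The vertices `0, e_1, …, e_n, (W, 4)` in `ℝ^{n+1}`. -/
def cyclicVertices {n : ℕ} (W : Fin n → ℝ) : Fin (n + 2) → Fin (n + 1) → ℝ :=
  Fin.cons 0 (Fin.snoc (fun j => stdE (n + 1) j.castSucc) (Fin.snoc W 4 : Fin (n + 1) → ℝ))

lemma sum_cyclicVertices_castSucc {n : ℕ} (W : Fin n → ℝ) (c : Fin (n + 2) → ℝ) (j : Fin n) :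
    ∑ i, c i * cyclicVertices W i j.castSucc =
      c j.castSucc.succ + c (Fin.last n).succ * W j := by
  simp [Fin.sum_univ_succ (n := n + 1), Fin.sum_univ_castSucc, cyclicVertices, stdE]

lemma sum_cyclicVertices_last {n : ℕ} (W : Fin n → ℝ) (c : Fin (n + 2) → ℝ) :
    ∑ i, c i * cyclicVertices W i (Fin.last n) = c (Fin.last n).succ * 4 := by
  simp [Fin.sum_univ_succ (n := n + 1), Fin.sum_univ_castSucc, cyclicVertices, stdE,
    (Fin.castSucc_lt_last _).ne']

lemma sum_eq_zero_add {n : ℕ} {M : Type*} [AddCommMonoid M] (c : Fin (n + 2) → M) :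
    ∑ i, c i = c 0 + (∑ j : Fin n, c j.castSucc.succ + c (Fin.last n).succ) := by
  rw [Fin.sum_univ_succ, Fin.sum_univ_castSucc]

lemma affineIndependent_cyclicVertices {n : ℕ} (W : Fin n → ℝ) :
    AffineIndependent ℝ (cyclicVertices W) := by
  refine affineIndependent_of_forall fun c hc hc' => ?_
  have h1 : c (Fin.last n).succ = 0 := by
    have := hc' (Fin.last n)
    rw [sum_cyclicVertices_last] at this
    linarith
  have h2 : ∀ j : Fin n, c j.castSucc.succ = 0 := fun j => by
    have := hc' j.castSucc
    rw [sum_cyclicVertices_castSucc, h1] at this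
    linarith
  have h3 : c 0 = 0 := by
    rw [sum_eq_zero_add, h1] at hc
    simpa [h2] using hc
  refine Fin.cases h3 fun i => Fin.lastCases h1 (fun j => h2 j) i

lemma isCyclicLattice_cyclicVertices {n : ℕ} {W : Fin n → ℝ} {β : Fin (n + 2) → ℤ}
    (hW : ∀ j, W j = 4 - β j.castSucc.succ) (hlast : β (Fin.last n).succ = 1)
    {m : ℤ} (hsum : ∑ i, β i = 4 * m) : IsCyclicLattice (cyclicVertices W) β := by
  intro c
  have hsum' : ∀ k : ℤ, ∑ i, (k * β i / 4 : ℝ) = (k * m : ℤ) := fun k => by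
    rw [← Finset.sum_div, ← Finset.mul_sum]
    have : ∑ i, (β i : ℝ) = 4 * m := by exact_mod_cast hsum
    rw [this]
    push_cast
    ring
  constructor
  · rintro ⟨h1, h2⟩
    have h3 := h1 (Fin.last n)
    rw [sum_cyclicVertices_last] at h3
    obtain ⟨k, hk⟩ := mem_intReals.1 h3
    have hk' : c (Fin.last n).succ = k / 4 := by linarith
    have h4 : c (Fin.last n).succ - k * β (Fin.last n).succ / 4 ∈ intReals := by
      rw [hlast, hk']
      simp
    have h5 : ∀ j : Fin n, c j.castSucc.succ - k * β j.castSucc.succ / 4 ∈ intReals := fun j => by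
      have := h1 j.castSucc
      rw [sum_cyclicVertices_castSucc, hk', hW] at this
      convert sub_mem this (intCast_mem_intReals k) using 1
      ring
    refine ⟨k, Fin.cases ?_ fun i => Fin.lastCases h4 (fun j => h5 j) i⟩
    have h6 : ∑ i, (c i - k * β i / 4) ∈ intReals := by
      rw [Finset.sum_sub_distrib, hsum']
      exact sub_mem h2 (intCast_mem_intReals _)
    rw [sum_eq_zero_add] at h6
    convert sub_mem h6 (add_mem (sum_mem fun j (_ : j ∈ Finset.univ) => h5 j) h4) using 1
    ring
  · rintro ⟨k, hk⟩
    refine ⟨fun j => ?_, ?_⟩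
    · have h := hk (Fin.last n).succ
      rw [hlast] at h
      refine Fin.lastCases ?_ (fun j => ?_) j
      · rw [sum_cyclicVertices_last]
        convert add_mem (mul_mem h (intCast_mem_intReals 4)) (intCast_mem_intReals k) using 1
        push_cast
        ring
      · rw [sum_cyclicVertices_castSucc, hW]
        convert add_mem (add_mem (hk j.castSucc.succ)
          (mul_mem h (intCast_mem_intReals (4 - β j.castSucc.succ)))) (intCast_mem_intReals k)
          using 1
        push_cast
        ring
    · have h : ∑ i, (c i - k * β i / 4) ∈ intReals := sum_mem fun i _ => hk i
      rw [Finset.sum_sub_distrib, hsum'] at h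
      simpa using add_mem h (intCast_mem_intReals (k * m))

lemma delta4Simplex1_eq {n p q r : ℕ} {W : Fin n → ℝ}
    (hW : ∀ j : Fin n, W j = if ((j : ℕ) : ℤ) + 1 ≤ (p : ℤ) - 2 * q + r then 2
      else if ((j : ℕ) : ℤ) + 1 ≤ 2 * (p : ℤ) - q then 1 else 3) :
    delta4Simplex1 (n + 1) p q r = convexHull ℝ (Set.range (cyclicVertices W)) := by
  rw [delta4Simplex1]
  have h1 : (fun j : Fin (n + 1) =>
        if (j : ℕ) = n + 1 - 1 then (4 : ℝ)
        else if ((j : ℕ) : ℤ) + 1 ≤ (p : ℤ) - 2 * (q : ℤ) + (r : ℤ) then 2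
        else if ((j : ℕ) : ℤ) + 1 ≤ 2 * (p : ℤ) - (q : ℤ) then 1 else 3) =
      (Fin.snoc W 4 : Fin (n + 1) → ℝ) := by
    funext j
    refine Fin.lastCases ?_ (fun j => ?_) j
    · simp
    · simp [hW, j.isLt.ne]
  rw [h1]
  congr 1
  ext x
  simp only [Set.mem_union, Set.mem_insert_iff, Set.mem_singleton_iff, Set.mem_ofPred_eq,
    Set.mem_range]
  constructor
  · rintro ((rfl | rfl) | ⟨j, hj, rfl⟩)
    · exact ⟨0, by simp [cyclicVertices]⟩
    · exact ⟨(Fin.last n).succ, by simp [cyclicVertices]⟩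
    · obtain ⟨i, rfl⟩ : ∃ i : Fin n, i.castSucc = j := ⟨⟨j, by omega⟩, rfl⟩
      exact ⟨i.castSucc.succ, by simp [cyclicVertices]⟩
  · rintro ⟨i, rfl⟩
    refine Fin.cases ?_ (fun i => Fin.lastCases ?_ (fun j => ?_) i) i
    · simp [cyclicVertices]
    · simp [cyclicVertices]
    · exact Or.inr ⟨j.castSucc, by simp, by simp [cyclicVertices]⟩

/-- A simplex with cyclic coefficient lattice of order four and no integral coefficient. -/
lemma unimodEquiv_delta4Simplex1 {d p q r : ℕ} {v : Fin (d + 1) → Fin d → ℝ}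
    (hv : AffineIndependent ℝ v) {α : Fin (d + 1) → ℤ} (hα : ∀ i, α i = 1 ∨ α i = 2 ∨ α i = 3)
    (hL : IsCyclicLattice v α) (hq : 1 ≤ q) (hpr : p ≤ r) (hp' : ∑ i, α i = 4 * p)
    (hq' : ∑ i, (2 * α i) % 4 = 4 * q) (hr' : ∑ i, (3 * α i) % 4 = 4 * r) :
    d + 1 = p + r ∧ 2 * q ≤ p + r ∧
      UnimodEquiv (convexHull ℝ (Set.range v)) (delta4Simplex1 d p q r) := by
  have e1 := sum_eq_of_values hα fun x => x
  have e2 := sum_eq_of_values hα fun x => (2 * x) % 4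
  have e3 := sum_eq_of_values hα fun x => (3 * x) % 4
  have e0 := sum_eq_of_values hα fun _ => 1
  simp only [Finset.sum_const, Finset.card_univ, Fintype.card_fin] at e0
  rw [hp'] at e1
  rw [hq'] at e2
  rw [hr'] at e3
  generalize hN1 : (Finset.univ.filter fun i => α i = 1).card = N1 at *
  generalize hN2 : (Finset.univ.filter fun i => α i = 2).card = N2 at *
  generalize hN3 : (Finset.univ.filter fun i => α i = 3).card = N3 at *
  norm_num at e0 e1 e2 e3
  refine ⟨by omega, by omega, ?_⟩
  obtain ⟨n, rfl⟩ : ∃ n, d = n + 1 := ⟨d - 1, by omega⟩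
  set h : ℕ → ℤ := fun k => if k = 0 then (if N1 = 1 then 3 else 1) else if n < k then 1
    else if k ≤ N2 then 2 else if k ≤ N2 + N3 then 3 else 1 with hh
  set β : Fin (n + 2) → ℤ := fun i => h i with hβ
  have hβv : ∀ i, β i = 1 ∨ β i = 2 ∨ β i = 3 := fun i => by
    simp only [hβ, hh]
    split_ifs <;> simp
  have c2 : (Finset.univ.filter fun i => β i = 2).card = N2 := by
    rw [card_filter_fin (n + 2) (fun k => h k = 2)]
    have : (Finset.range (n + 2)).filter (fun k => h k = 2) = Finset.Ico 1 (N2 + 1) := by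
      ext k
      simp only [Finset.mem_filter, Finset.mem_range, Finset.mem_Ico, hh]
      split_ifs <;> omega
    rw [this]
    simp
  have c3 : (Finset.univ.filter fun i => β i = 3).card = N3 := by
    rw [card_filter_fin (n + 2) (fun k => h k = 3)]
    by_cases hN : N1 = 1
    · have : (Finset.range (n + 2)).filter (fun k => h k = 3) = {0} := by
        ext k
        simp only [Finset.mem_filter, Finset.mem_range, Finset.mem_singleton, hh]
        split_ifs <;> omega
      rw [this, Finset.card_singleton]
      omega
    · have : (Finset.range (n + 2)).filter (fun k => h k = 3) =
          Finset.Ico (N2 + 1) (N2 + N3 + 1) := by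
        ext k
        simp only [Finset.mem_filter, Finset.mem_range, Finset.mem_Ico, hh]
        split_ifs <;> omega
      rw [this]
      simp
  obtain ⟨σ, hσ⟩ := exists_perm_of_card_eq hα hβv (hN2.trans c2.symm) (hN3.trans c3.symm)
  have hsum : ∑ i, β i = 4 * (p : ℤ) := by
    rw [← hp', ← Equiv.sum_comp σ]
    exact Finset.sum_congr rfl fun i _ => hσ i
  rw [delta4Simplex1_eq (W := fun j => 4 - β j.castSucc.succ)]
  · exact unimodEquiv_of_isCyclicLattice hv (affineIndependent_cyclicVertices _) hL
      (isCyclicLattice_cyclicVertices (fun _ => rfl) (by simp [hβ, hh]) hsum) σ hσ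
  · intro j
    have hj := j.isLt
    have e4 : (p : ℤ) - 2 * q + r = N2 := by omega
    have e5 : 2 * (p : ℤ) - q = N2 + N3 := by omega
    have hj' : ¬ n < (j : ℕ) + 1 := by omega
    have e6 : (((j : ℕ) : ℤ) + 1 ≤ N2) ↔ (j : ℕ) + 1 ≤ N2 := by omega
    have e7 : (((j : ℕ) : ℤ) + 1 ≤ N2 + N3) ↔ (j : ℕ) + 1 ≤ N2 + N3 := by omega
    simp only [hβ, hh, e4, e5, e6, e7, Fin.val_succ, Fin.val_castSucc, Nat.succ_ne_zero, if_false,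
      hj']
    split_ifs <;> norm_num


/-- The vertices `0, e_1, …, e_n, (U, 2, 0), (V, 0, 2)` in `ℝ^{n+2}`. -/
def kleinVertices {n : ℕ} (U V : Fin n → ℝ) : Fin (n + 3) → Fin (n + 2) → ℝ :=
  Fin.cons 0 (Fin.snoc (Fin.snoc (fun j => stdE (n + 2) j.castSucc.castSucc)
    (Fin.snoc (Fin.snoc U 2 : Fin (n + 1) → ℝ) 0 : Fin (n + 2) → ℝ))
    (Fin.snoc (Fin.snoc V 0 : Fin (n + 1) → ℝ) 2 : Fin (n + 2) → ℝ))

lemma sum_kleinVertices_castSucc_castSucc {n : ℕ} (U V : Fin n → ℝ) (c : Fin (n + 3) → ℝ)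
    (j : Fin n) : ∑ i, c i * kleinVertices U V i j.castSucc.castSucc =
      c j.castSucc.castSucc.succ + c (Fin.last n).castSucc.succ * U j +
        c (Fin.last (n + 1)).succ * V j := by
  simp [Fin.sum_univ_succ (n := n + 2), Fin.sum_univ_castSucc, kleinVertices, stdE]

lemma sum_kleinVertices_castSucc_last {n : ℕ} (U V : Fin n → ℝ) (c : Fin (n + 3) → ℝ) :
    ∑ i, c i * kleinVertices U V i (Fin.last n).castSucc =
      c (Fin.last n).castSucc.succ * 2 := by
  simp [Fin.sum_univ_succ (n := n + 2), Fin.sum_univ_castSucc, kleinVertices, stdE,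
    (Fin.castSucc_lt_last _).ne']

lemma sum_kleinVertices_last {n : ℕ} (U V : Fin n → ℝ) (c : Fin (n + 3) → ℝ) :
    ∑ i, c i * kleinVertices U V i (Fin.last (n + 1)) = c (Fin.last (n + 1)).succ * 2 := by
  simp [Fin.sum_univ_succ (n := n + 2), Fin.sum_univ_castSucc, kleinVertices, stdE,
    (Fin.castSucc_lt_last _).ne']

lemma sum_eq_zero_add_add {n : ℕ} {M : Type*} [AddCommMonoid M] (c : Fin (n + 3) → M) :
    ∑ i, c i = c 0 + (∑ j : Fin n, c j.castSucc.castSucc.succ + c (Fin.last n).castSucc.succ +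
      c (Fin.last (n + 1)).succ) := by
  rw [Fin.sum_univ_succ, Fin.sum_univ_castSucc, Fin.sum_univ_castSucc]

lemma affineIndependent_kleinVertices {n : ℕ} (U V : Fin n → ℝ) :
    AffineIndependent ℝ (kleinVertices U V) := by
  refine affineIndependent_of_forall fun c hc hc' => ?_
  have h1 : c (Fin.last n).castSucc.succ = 0 := by
    have := hc' (Fin.last n).castSucc
    rw [sum_kleinVertices_castSucc_last] at this
    linarith
  have h2 : c (Fin.last (n + 1)).succ = 0 := by
    have := hc' (Fin.last (n + 1))
    rw [sum_kleinVertices_last] at this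
    linarith
  have h3 : ∀ j : Fin n, c j.castSucc.castSucc.succ = 0 := fun j => by
    have := hc' j.castSucc.castSucc
    rw [sum_kleinVertices_castSucc_castSucc, h1, h2] at this
    linarith
  have h4 : c 0 = 0 := by
    rw [sum_eq_zero_add_add, h1, h2] at hc
    simpa [h3] using hc
  exact Fin.cases h4 fun i => Fin.lastCases h2 (fun i => Fin.lastCases h1 (fun j => h3 j) i) i

lemma isKleinLattice_kleinVertices {n : ℕ} {U V : Fin n → ℝ} {α β : Fin (n + 3) → ℤ}
    (hU : ∀ j, U j = α j.castSucc.castSucc.succ) (hV : ∀ j, V j = β j.castSucc.castSucc.succ)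
    (hαu : α (Fin.last n).castSucc.succ = 1) (hβu : β (Fin.last n).castSucc.succ = 0)
    (hαv : α (Fin.last (n + 1)).succ = 0) (hβv : β (Fin.last (n + 1)).succ = 1)
    {a b : ℤ} (hα : ∑ i, α i = 2 * a) (hβ : ∑ i, β i = 2 * b) :
    IsKleinLattice (kleinVertices U V) α β := by
  intro c
  have hsum : ∀ k l : ℤ, ∑ i, ((k * α i + l * β i) / 2 : ℝ) = (k * a + l * b : ℤ) := fun k l => by
    rw [← Finset.sum_div, Finset.sum_add_distrib, ← Finset.mul_sum, ← Finset.mul_sum]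
    have h1 : ∑ i, (α i : ℝ) = 2 * a := by exact_mod_cast hα
    have h2 : ∑ i, (β i : ℝ) = 2 * b := by exact_mod_cast hβ
    rw [h1, h2]
    push_cast
    ring
  constructor
  · rintro ⟨h1, h2⟩
    have h3 := h1 (Fin.last n).castSucc
    rw [sum_kleinVertices_castSucc_last] at h3
    obtain ⟨k, hk⟩ := mem_intReals.1 h3
    have hk' : c (Fin.last n).castSucc.succ = k / 2 := by linarith
    have h4 := h1 (Fin.last (n + 1))
    rw [sum_kleinVertices_last] at h4
    obtain ⟨l, hl⟩ := mem_intReals.1 h4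
    have hl' : c (Fin.last (n + 1)).succ = l / 2 := by linarith
    set D : Fin (n + 3) → ℝ := fun i => c i - (k * α i + l * β i) / 2 with hD
    have h5 : D (Fin.last n).castSucc.succ ∈ intReals := by
      simp only [hD, hαu, hβu, hk']
      simp
    have h6 : D (Fin.last (n + 1)).succ ∈ intReals := by
      simp only [hD, hαv, hβv, hl']
      simp
    have h7 : ∀ j : Fin n, D j.castSucc.castSucc.succ ∈ intReals := fun j => by
      have := h1 j.castSucc.castSucc
      rw [sum_kleinVertices_castSucc_castSucc, hk', hl', hU, hV] at this
      convert sub_mem this (intCast_mem_intReals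
        (k * α j.castSucc.castSucc.succ + l * β j.castSucc.castSucc.succ)) using 1
      simp only [hD]
      push_cast
      ring
    refine ⟨k, l, Fin.cases (?_ : D 0 ∈ intReals) fun i => Fin.lastCases h6
      (fun i => Fin.lastCases h5 (fun j => h7 j) i) i⟩
    have h8 : ∑ i, D i ∈ intReals := by
      simp only [hD]
      rw [Finset.sum_sub_distrib, hsum]
      exact sub_mem h2 (intCast_mem_intReals _)
    rw [sum_eq_zero_add_add] at h8
    convert sub_mem h8 (add_mem (add_mem (sum_mem fun j (_ : j ∈ Finset.univ) => h7 j) h5) h6)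
      using 1
    ring
  · rintro ⟨k, l, hk⟩
    refine ⟨fun j => ?_, ?_⟩
    · have h := hk (Fin.last n).castSucc.succ
      have h' := hk (Fin.last (n + 1)).succ
      rw [hαu, hβu] at h
      rw [hαv, hβv] at h'
      refine Fin.lastCases ?_ (fun j => Fin.lastCases ?_ (fun j => ?_) j) j
      · rw [sum_kleinVertices_last]
        convert add_mem (mul_mem h' (intCast_mem_intReals 2)) (intCast_mem_intReals l) using 1
        push_cast
        ring
      · rw [sum_kleinVertices_castSucc_last]
        convert add_mem (mul_mem h (intCast_mem_intReals 2)) (intCast_mem_intReals k) using 1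
        push_cast
        ring
      · rw [sum_kleinVertices_castSucc_castSucc, hU, hV]
        set A := α j.castSucc.castSucc.succ with hA
        set B := β j.castSucc.castSucc.succ with hB
        convert add_mem (add_mem (hk j.castSucc.castSucc.succ)
          (add_mem (mul_mem h (intCast_mem_intReals A)) (mul_mem h' (intCast_mem_intReals B))))
          (intCast_mem_intReals (k * A + l * B)) using 1
        rw [← hA, ← hB]
        push_cast
        ring
    · have h : ∑ i, (c i - (k * α i + l * β i) / 2) ∈ intReals := sum_mem fun i _ => hk i
      rw [Finset.sum_sub_distrib, hsum] at h
      simpa using add_mem h (intCast_mem_intReals (k * a + l * b))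

lemma delta4Simplex3_eq {n i1 i2 i3 : ℕ} {U V : Fin n → ℝ}
    (hU : ∀ j : Fin n, U j = if -(i1 : ℤ) + i2 + i3 ≤ ((j : ℕ) : ℤ) + 1 then 1 else 0)
    (hV : ∀ j : Fin n, V j = if ((j : ℕ) : ℤ) + 1 ≤ -(i1 : ℤ) + i2 + i3 - 1 ∨
      2 * (i3 : ℤ) - 1 ≤ ((j : ℕ) : ℤ) + 1 then 1 else 0) (hi1 : 1 ≤ i1)
    (hn : n + 3 = i1 + i2 + i3) :
    delta4Simplex3 (n + 2) i1 i2 i3 = convexHull ℝ (Set.range (kleinVertices U V)) := by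
  rw [delta4Simplex3]
  have h1 : (fun j : Fin (n + 2) =>
        if (j : ℕ) = n + 2 - 2 then (2 : ℝ)
        else if (-(i1 : ℤ) + (i2 : ℤ) + (i3 : ℤ) ≤ ((j : ℕ) : ℤ) + 1 ∧
            ((j : ℕ) : ℤ) + 1 ≤ ((n + 2 : ℕ) : ℤ) - 2) then 1 else 0) =
      (Fin.snoc (Fin.snoc U 2 : Fin (n + 1) → ℝ) 0 : Fin (n + 2) → ℝ) := by
    funext j
    refine Fin.lastCases ?_ (fun j => Fin.lastCases ?_ (fun j => ?_) j) j
    · simp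
    · simp
    · have := j.isLt
      have h2 : ((j : ℕ) : ℤ) + 1 ≤ ((n + 2 : ℕ) : ℤ) - 2 := by omega
      simp only [Fin.val_castSucc, h2, and_true, Fin.snoc_castSucc, hU]
      rw [if_neg (by omega)]
  have h2 : (fun j : Fin (n + 2) =>
        if (j : ℕ) = n + 2 - 1 then (2 : ℝ)
        else if (((j : ℕ) : ℤ) + 1 ≤ -(i1 : ℤ) + (i2 : ℤ) + (i3 : ℤ) - 1 ∨
            (2 * (i3 : ℤ) - 1 ≤ ((j : ℕ) : ℤ) + 1 ∧
              ((j : ℕ) : ℤ) + 1 ≤ ((n + 2 : ℕ) : ℤ) - 2))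
          then 1 else 0) =
      (Fin.snoc (Fin.snoc V 0 : Fin (n + 1) → ℝ) 2 : Fin (n + 2) → ℝ) := by
    funext j
    refine Fin.lastCases ?_ (fun j => Fin.lastCases ?_ (fun j => ?_) j) j
    · simp
    · simp only [Fin.val_castSucc, Fin.val_last, Fin.snoc_castSucc, Fin.snoc_last]
      rw [if_neg (by omega), if_neg (by omega)]
    · have := j.isLt
      have h2 : ((j : ℕ) : ℤ) + 1 ≤ ((n + 2 : ℕ) : ℤ) - 2 := by omega
      simp only [Fin.val_castSucc, h2, and_true, Fin.snoc_castSucc, hV]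
      rw [if_neg (by omega)]
  rw [h1, h2]
  congr 1
  ext x
  simp only [Set.mem_union, Set.mem_insert_iff, Set.mem_singleton_iff, Set.mem_ofPred_eq,
    Set.mem_range]
  constructor
  · rintro ((rfl | rfl | rfl) | ⟨j, hj, rfl⟩)
    · exact ⟨0, by simp [kleinVertices]⟩
    · exact ⟨(Fin.last n).castSucc.succ, by simp [kleinVertices]⟩
    · exact ⟨(Fin.last (n + 1)).succ, by simp [kleinVertices]⟩
    · obtain ⟨i, rfl⟩ : ∃ i : Fin n, i.castSucc.castSucc = j := ⟨⟨j, by omega⟩, rfl⟩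
      exact ⟨i.castSucc.castSucc.succ, by simp [kleinVertices]⟩
  · rintro ⟨i, rfl⟩
    refine Fin.cases ?_ (fun i => Fin.lastCases ?_
      (fun i => Fin.lastCases ?_ (fun j => ?_) i) i) i
    · simp [kleinVertices]
    · simp [kleinVertices]
    · simp [kleinVertices]
    · exact Or.inr ⟨j.castSucc.castSucc, by simp, by simp [kleinVertices]⟩

/-- A simplex with Klein coefficient lattice and no integral coefficient. -/
lemma unimodEquiv_delta4Simplex3 {d i1 i2 i3 : ℕ} {v : Fin (d + 1) → Fin d → ℝ}
    (hv : AffineIndependent ℝ v) (hi1 : 1 ≤ i1) (h12 : i1 ≤ i2) (h23 : i2 ≤ i3)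
    {α β : Fin (d + 1) → ℤ} (hα : ∀ i, 0 ≤ α i ∧ α i < 2) (hβ : ∀ i, 0 ≤ β i ∧ β i < 2)
    (hαβ : ∀ i, α i ≠ 0 ∨ β i ≠ 0) (hL : IsKleinLattice v α β)
    (h1 : ∑ i, α i = 2 * i1) (h2 : ∑ i, β i = 2 * i2)
    (h3 : ∑ i, (α i + β i) % 2 = 2 * i3) :
    d + 1 = i1 + i2 + i3 ∧ UnimodEquiv (convexHull ℝ (Set.range v)) (delta4Simplex3 d i1 i2 i3) := by
  set γ : Fin (d + 1) → ℤ := fun i => 2 - α i + β i with hγ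
  have hγv : ∀ i, γ i = 1 ∨ γ i = 2 ∨ γ i = 3 := fun i => by
    have := hα i
    have := hβ i
    have := hαβ i
    simp only [hγ]
    omega
  have hαγ : ∀ i, α i = if γ i = 3 then 0 else 1 := fun i => by
    have := hα i
    have := hβ i
    have := hαβ i
    simp only [hγ]
    split_ifs <;> omega
  have hβγ : ∀ i, β i = if γ i = 1 then 0 else 1 := fun i => by
    have := hα i
    have := hβ i
    have := hαβ i
    simp only [hγ]
    split_ifs <;> omega
  have hsumγ : ∀ i, (α i + β i) % 2 = if γ i = 2 then 0 else 1 := fun i => by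
    have := hα i
    have := hβ i
    have := hαβ i
    simp only [hγ]
    split_ifs <;> omega
  clear_value γ
  have e0 := sum_eq_of_values hγv fun _ => 1
  have e1 := sum_eq_of_values hγv fun x => if x = 3 then 0 else 1
  have e2 := sum_eq_of_values hγv fun x => if x = 1 then 0 else 1
  have e3 := sum_eq_of_values hγv fun x => if x = 2 then 0 else 1
  simp only [Finset.sum_const, Finset.card_univ, Fintype.card_fin] at e0
  simp only [← hαγ, h1] at e1
  simp only [← hβγ, h2] at e2
  simp only [← hsumγ, h3] at e3
  generalize hN1 : (Finset.univ.filter fun i => γ i = 1).card = N1 at *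
  generalize hN2 : (Finset.univ.filter fun i => γ i = 2).card = N2 at *
  generalize hN3 : (Finset.univ.filter fun i => γ i = 3).card = N3 at *
  norm_num at e0 e1 e2 e3
  refine ⟨by omega, ?_⟩
  obtain ⟨n, rfl⟩ : ∃ n, d = n + 2 := ⟨d - 2, by omega⟩
  set h : ℕ → ℤ := fun k => if k = 0 then (if N2 = 0 then 1 else 2) else if k = n + 1 then 1
    else if n + 1 < k then 3 else if k + 1 ≤ N3 then 3 else if k + 2 ≤ N3 + N1 then 1 else 2 with hh
  set δ : Fin (n + 3) → ℤ := fun i => h i with hδ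
  have hδv : ∀ i, δ i = 1 ∨ δ i = 2 ∨ δ i = 3 := fun i => by
    simp only [hδ, hh]
    split_ifs <;> simp
  have c2 : (Finset.univ.filter fun i => δ i = 2).card = N2 := by
    rw [card_filter_fin (n + 3) (fun k => h k = 2)]
    rcases Nat.eq_zero_or_pos N2 with hN | hN
    · rw [Finset.filter_false_of_mem, Finset.card_empty, hN]
      intro k hk
      rw [Finset.mem_range] at hk
      simp only [hh]
      split_ifs <;> omega
    · have : (Finset.range (n + 3)).filter (fun k => h k = 2) =
          insert 0 (Finset.Ico (N3 + N1 - 1) (n + 1)) := by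
        ext k
        simp only [Finset.mem_filter, Finset.mem_range, Finset.mem_insert, Finset.mem_Ico, hh]
        split_ifs <;> omega
      rw [this, Finset.card_insert_of_notMem (by rw [Finset.mem_Ico]; omega), Nat.card_Ico]
      omega
  have c3 : (Finset.univ.filter fun i => δ i = 3).card = N3 := by
    rw [card_filter_fin (n + 3) (fun k => h k = 3)]
    have : (Finset.range (n + 3)).filter (fun k => h k = 3) =
        insert (n + 2) (Finset.Ico 1 N3) := by
      ext k
      simp only [Finset.mem_filter, Finset.mem_range, Finset.mem_insert, Finset.mem_Ico, hh]
      split_ifs <;> omega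
    rw [this, Finset.card_insert_of_notMem (by rw [Finset.mem_Ico]; omega), Nat.card_Ico]
    omega
  obtain ⟨σ, hσ⟩ := exists_perm_of_card_eq hγv hδv (hN2.trans c2.symm) (hN3.trans c3.symm)
  set α' : Fin (n + 3) → ℤ := fun i => if δ i = 3 then 0 else 1 with hα'
  set β' : Fin (n + 3) → ℤ := fun i => if δ i = 1 then 0 else 1 with hβ'
  have hσα : ∀ i, α' (σ i) = α i := fun i => by simp only [hα', hσ, hαγ]
  have hσβ : ∀ i, β' (σ i) = β i := fun i => by simp only [hβ', hσ, hβγ]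
  have hsα : ∑ i, α' i = 2 * (i1 : ℤ) := by
    rw [← h1, ← Equiv.sum_comp σ]
    exact Finset.sum_congr rfl fun i _ => hσα i
  have hsβ : ∑ i, β' i = 2 * (i2 : ℤ) := by
    rw [← h2, ← Equiv.sum_comp σ]
    exact Finset.sum_congr rfl fun i _ => hσβ i
  have hδj : ∀ j : Fin n, δ j.castSucc.castSucc.succ =
      if (j : ℕ) + 2 ≤ N3 then 3 else if (j : ℕ) + 3 ≤ N3 + N1 then 1 else 2 := fun j => by
    have h4 := j.isLt.ne
    simp [hδ, hh, h4, add_assoc, -Order.add_one_le_iff]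
  rw [delta4Simplex3_eq (U := fun j => α' j.castSucc.castSucc.succ)
    (V := fun j => β' j.castSucc.castSucc.succ) _ _ hi1 (by omega)]
  · refine unimodEquiv_of_isKleinLattice hv (affineIndependent_kleinVertices _ _) hL
      (isKleinLattice_kleinVertices (fun _ => rfl) (fun _ => rfl) ?_ ?_ ?_ ?_ hsα hsβ) σ hσα hσβ
    all_goals simp [hα', hβ', hδ, hh]
  · intro j
    have h4 : -(i1 : ℤ) + i2 + i3 ≤ ((j : ℕ) : ℤ) + 1 ↔ ¬ (j : ℕ) + 2 ≤ N3 := by omega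
    simp only [hα', hδj, h4]
    by_cases h6 : (j : ℕ) + 2 ≤ N3
    · simp [h6]
    · by_cases h7 : (j : ℕ) + 3 ≤ N3 + N1 <;> simp [h6, h7]
  · intro j
    have h4 : ((j : ℕ) : ℤ) + 1 ≤ -(i1 : ℤ) + i2 + i3 - 1 ↔ (j : ℕ) + 2 ≤ N3 := by omega
    have h5 : 2 * (i3 : ℤ) - 1 ≤ ((j : ℕ) : ℤ) + 1 ↔ ¬ (j : ℕ) + 3 ≤ N3 + N1 := by omega
    simp only [hβ', hδj, h4, h5]
    by_cases h6 : (j : ℕ) + 2 ≤ N3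
    · simp [h6]
    · by_cases h7 : (j : ℕ) + 3 ≤ N3 + N1 <;> simp [h6, h7]

lemma delta4Simplex2_eq (d i1 i2 i3 : ℕ) :
    delta4Simplex2 d i1 i2 i3 = delta4Simplex1 d i2 i1 i3 := by
  have h1 : -2 * (i1 : ℤ) + i2 + i3 = i2 - 2 * i1 + i3 := by ring
  have h2 : -(i1 : ℤ) + 2 * i2 = 2 * i2 - i1 := by ring
  rw [delta4Simplex2, delta4Simplex1, h1, h2]

lemma cyclic_heights_cases {p q r i1 i2 i3 : ℕ} (h12 : i1 ≤ i2) (h23 : i2 ≤ i3)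
    (h : ({p, q, r} : Multiset ℕ) = {i1, i2, i3}) (hpr : p ≤ r) (hq : 2 * q ≤ p + r) :
    (p = i1 ∧ q = i2 ∧ r = i3 ∧ i1 < i2 ∧ i2 < i3) ∨ (p = i2 ∧ q = i1 ∧ r = i3) := by
  have hmem : ∀ x, (x = p ∨ x = q ∨ x = r) ↔ (x = i1 ∨ x = i2 ∨ x = i3) := fun x => by
    simpa using congrArg (x ∈ ·) h
  have hsum : p + (q + r) = i1 + (i2 + i3) := by simpa using congrArg Multiset.sum h
  have h1 := (hmem i1).2 (by simp)
  have h2 := (hmem i2).2 (by simp)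
  have h3 := (hmem i3).2 (by simp)
  have hp := (hmem p).1 (by simp)
  have hr := (hmem r).1 (by simp)
  clear hmem h
  rcases hp with rfl | rfl | rfl <;> rcases hr with rfl | rfl | rfl <;> omega

lemma simplex_volume_four_cases {d i1 i2 i3 : ℕ} (hi1 : 1 ≤ i1) (h12 : i1 ≤ i2) (h23 : i2 ≤ i3)
    {Δ : Set (Fin d → ℝ)} (hΔ : IsLatticeSimplexFD Δ)
    (hδ : HasDeltaPoly Δ (1 + X ^ i1 + X ^ i2 + X ^ i3)) (hpyr : ¬ IsLatticePyramid Δ) :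
    ((i1 < i2 ∧ i2 < i3 ∧ 2 * i2 ≤ i1 + i3 ∧ d = i1 + i3 - 1) ∧
      UnimodEquiv Δ (delta4Simplex1 d i1 i2 i3)) ∨
    (d = i2 + i3 - 1 ∧ UnimodEquiv Δ (delta4Simplex2 d i1 i2 i3)) ∨
    (d = i1 + i2 + i3 - 1 ∧ UnimodEquiv Δ (delta4Simplex3 d i1 i2 i3)) := by
  obtain ⟨v, hv, hvl, rfl⟩ := hΔ
  have hht := map_height_eq hv hvl hδ
  by_cases hex : ∃ g ∈ simplexLambda v, ∃ i, 2 * g i ∉ intReals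
  · obtain ⟨α, p, q, r, hα, hL, hpqr, hpr, hp, hq, hr⟩ := exists_isCyclicLattice hv hvl hht hex
    have hpos : ∀ x ∈ ({p, q, r} : Multiset ℕ), 1 ≤ x := by
      rw [hpqr]
      intro x hx
      simp only [Multiset.insert_eq_cons, Multiset.mem_cons, Multiset.mem_singleton] at hx
      omega
    have hp1 : 1 ≤ p := hpos p (by simp)
    have hq1 : 1 ≤ q := hpos q (by simp)
    have hd : 0 < d := by
      rcases Nat.eq_zero_or_pos d with rfl | hd
      · have := hα 0
        simp at hp
        omega
      · exact hd
    have hα' : ∀ i, α i = 1 ∨ α i = 2 ∨ α i = 3 := fun i => by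
      have h0 : α i ≠ 0 := fun h0 => hpyr <|
        isLatticePyramid_of_forall_coeff_int hd hv hvl i fun c hc => by
          obtain ⟨k, hk⟩ := (hL c).1 hc
          simpa [h0] using hk i
      have := hα i
      omega
    obtain ⟨h1, h2, h3⟩ := unimodEquiv_delta4Simplex1 hv hα' hL hq1 hpr hp hq hr
    rcases cyclic_heights_cases h12 h23 hpqr hpr h2 with
      ⟨rfl, rfl, rfl, h4, h5⟩ | ⟨rfl, rfl, rfl⟩
    · exact Or.inl ⟨⟨h4, h5, h2, by omega⟩, h3⟩
    · refine Or.inr (Or.inl ⟨by omega, ?_⟩)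
      rwa [delta4Simplex2_eq]
  · push Not at hex
    obtain ⟨α, β, hα, hβ, hL, h1, h2, h3⟩ := exists_isKleinLattice hv hvl hht hex
    have hd : 0 < d := by
      rcases Nat.eq_zero_or_pos d with rfl | hd
      · have := hα 0
        simp at h1
        omega
      · exact hd
    have hαβ : ∀ i, α i ≠ 0 ∨ β i ≠ 0 := fun i => by
      by_contra! h0
      refine hpyr (isLatticePyramid_of_forall_coeff_int hd hv hvl i fun c hc => ?_)
      obtain ⟨k, l, hk⟩ := (hL c).1 hc
      simpa [h0.1, h0.2] using hk i
    obtain ⟨h4, h5⟩ := unimodEquiv_delta4Simplex3 hv hi1 h12 h23 hα hβ hαβ hL h1 h2 h3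
    exact Or.inr (Or.inr ⟨by omega, h5⟩)

/-- classification of lattice simplices of normalized volume 4 which are
not lattice pyramids. -/
theorem simplex_volume_four_classification {d i1 i2 i3 : ℕ} (hi1 : 1 ≤ i1) (h12 : i1 ≤ i2)
    (h23 : i2 ≤ i3) (Δ : Set (Fin d → ℝ)) (hΔ : IsLatticeSimplexFD Δ)
    (hδ : HasDeltaPoly Δ (1 + X ^ i1 + X ^ i2 + X ^ i3))
    (hpyr : ¬ IsLatticePyramid Δ) :
    let C1 := (i1 < i2 ∧ i2 < i3 ∧ 2 * i2 ≤ i1 + i3 ∧ d = i1 + i3 - 1) ∧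
      UnimodEquiv Δ (delta4Simplex1 d i1 i2 i3)
    let C2 := d = i2 + i3 - 1 ∧ UnimodEquiv Δ (delta4Simplex2 d i1 i2 i3)
    let C3 := d = i1 + i2 + i3 - 1 ∧ UnimodEquiv Δ (delta4Simplex3 d i1 i2 i3)
    (C1 ∨ C2 ∨ C3) ∧ ¬(C1 ∧ C2) ∧ ¬(C1 ∧ C3) ∧ ¬(C2 ∧ C3) := by
  intro C1 C2 C3
  refine ⟨simplex_volume_four_cases hi1 h12 h23 hΔ hδ hpyr, ?_, ?_, ?_⟩
  · rintro ⟨⟨⟨_, _, _, _⟩, _⟩, _, _⟩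
    omega
  · rintro ⟨⟨⟨_, _, _, _⟩, _⟩, _, _⟩
    omega
  · rintro ⟨⟨_, _⟩, _, _⟩
    omega
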